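/- arXiv:math/0007072 — 6 statements merged into one kernel-verified Lean document; each statement's English description precedes it below -/
import Mathlib

section
/- For integers r ≥ 1 and n ≥ 2, the subalgebra of A_r(n)-invariant polynomials in ℂ[Z_1,…,Z_n] is generated as a ℂ-algebra by the n+1 polynomials X := Z_1⋯Z_n and Y_j := Z_j^{r+1} for j = 1,…,n. -/
open MvPolynomial

theorem coeff_aeval_C_mul_X {σ R : Type*} [Fintype σ] [CommSemiring R] (d : σ → R)
    (p : MvPolynomial σ R) (m : σ →₀ ℕ) :
    coeff m (aeval (fun i => C (d i) * X i) p) = (∏ i, d i ^ m i) * coeff m p := by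
  classical
  induction p using MvPolynomial.induction_on' with
  | monomial s a =>
    have h : aeval (fun i => C (d i) * X i) (monomial s a) =
        monomial s ((∏ i, d i ^ s i) * a) := by
      rw [aeval_monomial, Finsupp.prod_pow, monomial_eq, Finsupp.prod_pow]
      simp only [mul_pow, Finset.prod_mul_distrib, algebraMap_eq, map_mul, map_prod, map_pow]
      ring
    rw [h, coeff_monomial, coeff_monomial]
    split_ifs with hs
    · rw [hs]
    · rw [mul_zero]
  | add p q hp hq => rw [map_add, coeff_add, coeff_add, hp, hq, mul_add]

theorem prod_mulSingle_pow {σ M : Type*} [Fintype σ] [DecidableEq σ] [CommMonoid M]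
    (i : σ) (a : M) (m : σ → ℕ) :
    ∏ k, (Pi.mulSingle i a : σ → M) k ^ m k = a ^ m i := by
  rw [Fintype.prod_eq_single i, Pi.mulSingle_eq_same]
  intro k hk
  rw [Pi.mulSingle_eq_of_ne hk, one_pow]

/-- If all the characters `d ↦ ∏ i, d i ^ m i` are trivial on the diagonal matrices of determinant
one and exponent `k`, then the entries of `m` are congruent modulo `k`. -/
theorem modEq_of_forall_prod_pow_eq_one {σ K : Type*} [Fintype σ] [Field K] {k : ℕ} {ζ : K}
    (hζ : IsPrimitiveRoot ζ k) (hk : k ≠ 0) (m : σ → ℕ)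
    (h : ∀ d : σ → K, (∀ i, d i ^ k = 1) → ∏ i, d i = 1 → ∏ i, d i ^ m i = 1) (i j : σ) :
    m i ≡ m j [MOD k] := by
  classical
  have hζ0 : ζ ≠ 0 := hζ.ne_zero hk
  have single_pow (l : σ) (a : K) (ha : a ^ k = 1) (x : σ) :
      (Pi.mulSingle l a : σ → K) x ^ k = 1 := by
    rcases eq_or_ne x l with rfl | hx
    · rwa [Pi.mulSingle_eq_same]
    · rw [Pi.mulSingle_eq_of_ne hx, one_pow]
  have key := h (Pi.mulSingle i ζ * Pi.mulSingle j ζ⁻¹)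
    (fun x => by
      rw [Pi.mul_apply, mul_pow, single_pow i ζ hζ.pow_eq_one,
        single_pow j ζ⁻¹ (by rw [inv_pow, hζ.pow_eq_one, inv_one]), mul_one])
    (by
      have h₁ := prod_mulSingle_pow i ζ (fun _ => 1)
      have h₂ := prod_mulSingle_pow j ζ⁻¹ (fun _ => 1)
      simp only [pow_one] at h₁ h₂
      simp only [Pi.mul_apply, Finset.prod_mul_distrib]
      rw [h₁, h₂, mul_inv_cancel₀ hζ0])
  simp only [Pi.mul_apply, mul_pow, Finset.prod_mul_distrib] at key
  rw [prod_mulSingle_pow, prod_mulSingle_pow, inv_pow, mul_inv_eq_one₀ (pow_ne_zero _ hζ0)] at key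
  rw [hζ.eq_orderOf]
  exact (hζ.isOfFinOrder hk).pow_eq_pow_iff_modEq.mp key

theorem monomial_mem_adjoin_of_modEq {σ R : Type*} [Fintype σ] [CommSemiring R] (k q : ℕ)
    (m : σ →₀ ℕ) (hm : ∀ i, m i % k = q) (a : R) :
    monomial m a ∈ Algebra.adjoin R (insert (∏ i, (X i : MvPolynomial σ R))
      (Set.range fun j : σ => (X j : MvPolynomial σ R) ^ k)) := by
  have h : monomial m a =
      C a * ((∏ i, (X i : MvPolynomial σ R)) ^ q * ∏ i, ((X i : MvPolynomial σ R) ^ k) ^ (m i / k)) := by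
    rw [monomial_eq, Finsupp.prod_pow, ← Finset.prod_pow, ← Finset.prod_mul_distrib]
    congr 1
    refine Finset.prod_congr rfl fun i _ => ?_
    rw [← pow_mul, ← pow_add, ← hm i, Nat.mod_add_div]
  rw [h]
  refine mul_mem (Subalgebra.algebraMap_mem _ a) (mul_mem (pow_mem ?_ _) (prod_mem fun i _ => pow_mem ?_ _))
  · exact Algebra.subset_adjoin (Set.mem_insert _ _)
  · exact Algebra.subset_adjoin (Set.mem_insert_of_mem _ ⟨i, rfl⟩)

/-- For `r ≥ 1`, `n ≥ 2`, the `A_r(n)`-invariant polynomials in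
`ℂ[Z_1,…,Z_n]` form the `ℂ`-subalgebra generated by `X = Z_1⋯Z_n` and
`Y_j = Z_j^(r+1)`, `j = 1,…,n`. -/
theorem Ar_invariants_generated_by_X_and_Y (r n : ℕ) (hr : 1 ≤ r) (hn : 2 ≤ n) :
    {p : MvPolynomial (Fin n) ℂ |
        ∀ d : Fin n → ℂ, (∀ i, d i ^ (r + 1) = 1) → ∏ i, d i = 1 →
          aeval (fun i => C (d i) * X i) p = p} =
      ↑(Algebra.adjoin ℂ
        (insert (∏ i, (X i : MvPolynomial (Fin n) ℂ))
          (Set.range fun j : Fin n => (X j : MvPolynomial (Fin n) ℂ) ^ (r + 1)))) := by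
  ext p
  simp only [Set.mem_ofPred_eq, SetLike.mem_coe]
  constructor
  · intro hp
    rw [p.as_sum]
    refine sum_mem fun m hm => ?_
    have hmod := modEq_of_forall_prod_pow_eq_one (Complex.isPrimitiveRoot_exp (r + 1) (by omega))
      (by omega) m fun d hd hd' => by
        have h := coeff_aeval_C_mul_X d p m
        rw [hp d hd hd'] at h
        exact (right_eq_mul₀ (mem_support_iff.mp hm)).mp h
    exact monomial_mem_adjoin_of_modEq (r + 1) (m ⟨0, by omega⟩ % (r + 1)) m
      (fun i => hmod i _) _
  · intro hp d hd hd'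
    induction hp using Algebra.adjoin_induction with
    | mem x hx =>
      rcases hx with rfl | ⟨j, rfl⟩
      · simp only [map_prod, aeval_X]
        rw [Finset.prod_mul_distrib, ← map_prod, hd', map_one, one_mul]
      · simp only [map_pow, aeval_X]
        rw [mul_pow, ← map_pow, hd, map_one, one_mul]
    | algebraMap a => rw [AlgHom.commutes]
    | add x y _ _ hx hy => rw [map_add, hx, hy]
    | mul x y _ _ hx hy => rw [map_mul, hx, hy]
end

section
/- For integers r ≥ 1 and n ≥ 2, let I(o) be the ideal of ℂ[Z_1,…,Z_n] generated by Z_1^{r+1}, …, Z_n^{r+1} and Z_1⋯Z_n. Then the quotient ℂ[Z_1,…,Z_n]/I(o) is a ℂ-vector space of dimension (r+1)^n − r^n, and the classes of the monomials Z^I = Z_1^{i_1}⋯Z_n^{i_n} with 0 ≤ i_j ≤ r for all j and i_1 i_2 ⋯ i_n = 0 (i.e. at least one exponent is zero) form a ℂ-basis of this quotient. -/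
open MvPolynomial

/-- If membership in the ideal `J` means that no exponent in the support satisfies `P`, the classes
of the monomials whose exponent satisfies `P` are linearly independent modulo `J`. -/
theorem linearIndependent_mk_monomial {σ K : Type*} [Field K] {J : Ideal (MvPolynomial σ K)}
    {P : (σ →₀ ℕ) → Prop} (hJ : ∀ p, p ∈ J ↔ ∀ m ∈ p.support, ¬ P m) :
    LinearIndependent K
      (fun m : {m // P m} => Ideal.Quotient.mk J (monomial m.1 (1 : K))) := by
  classical
  rw [linearIndependent_iff']
  intro s g hg i hi
  have hsum : ∑ m ∈ s, g m • Ideal.Quotient.mk J (monomial m.1 (1 : K)) =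
      Ideal.Quotient.mk J (∑ m ∈ s, monomial m.1 (g m)) := by
    rw [map_sum]
    refine Finset.sum_congr rfl fun m _ => ?_
    rw [← Ideal.Quotient.mkₐ_eq_mk K, ← map_smul, smul_monomial, smul_eq_mul, mul_one]
  rw [hsum, Ideal.Quotient.eq_zero_iff_mem, hJ] at hg
  by_contra hne
  refine hg i.1 ?_ i.2
  have hcoeff : coeff i.1 (∑ m ∈ s, monomial m.1 (g m)) = g i := by
    rw [coeff_sum, Finset.sum_eq_single i]
    · simp
    · intro m _ hm
      rw [coeff_monomial, if_neg fun h => hm (Subtype.ext h)]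
    · exact fun h => absurd hi h
  rw [mem_support_iff, hcoeff]
  exact hne

/-- If the ideal `J` contains every monomial whose exponent does not satisfy `P`, the classes of the
monomials whose exponent satisfies `P` span the quotient by `J`. -/
theorem span_range_mk_monomial {σ K : Type*} [Field K] {J : Ideal (MvPolynomial σ K)}
    {P : (σ →₀ ℕ) → Prop} (hJ : ∀ m, ¬ P m → monomial m (1 : K) ∈ J) :
    Submodule.span K (Set.range
      (fun m : {m // P m} => Ideal.Quotient.mk J (monomial m.1 (1 : K)))) = ⊤ := by
  rw [eq_top_iff]
  rintro x -
  obtain ⟨p, rfl⟩ := Ideal.Quotient.mk_surjective x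
  rw [p.as_sum, map_sum]
  refine Submodule.sum_mem _ fun m _ => ?_
  have hm : Ideal.Quotient.mk J (monomial m (coeff m p)) =
      coeff m p • Ideal.Quotient.mk J (monomial m (1 : K)) := by
    rw [← Ideal.Quotient.mkₐ_eq_mk K, ← map_smul, smul_monomial, smul_eq_mul, mul_one]
  rw [hm]
  refine Submodule.smul_mem _ _ ?_
  by_cases h : P m
  · exact Submodule.subset_span ⟨⟨m, h⟩, rfl⟩
  · rw [Ideal.Quotient.eq_zero_iff_mem.mpr (hJ m h)]
    exact Submodule.zero_mem _

theorem mem_span_prod_X_X_pow_iff {σ K : Type*} [Fintype σ] [Field K] (r : ℕ)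
    (p : MvPolynomial σ K) :
    p ∈ Ideal.span (insert (∏ i, (X i : MvPolynomial σ K))
        (Set.range fun i : σ => (X i : MvPolynomial σ K) ^ (r + 1))) ↔
      ∀ m ∈ p.support, ¬ ((∀ j, m j ≤ r) ∧ ∃ j, m j = 0) := by
  have hprod : (∏ i, (X i : MvPolynomial σ K)) =
      monomial (Finsupp.equivFunOnFinite.symm fun _ => 1) 1 := by
    rw [monomial_eq, Finsupp.prod_fintype _ _ (by simp)]
    simp
  have himage : insert (∏ i, (X i : MvPolynomial σ K))
        (Set.range fun i : σ => (X i : MvPolynomial σ K) ^ (r + 1)) =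
      (fun m => monomial m (1 : K)) '' insert (Finsupp.equivFunOnFinite.symm fun _ => 1)
        (Set.range fun i : σ => Finsupp.single i (r + 1)) := by
    rw [Set.image_insert_eq, hprod, ← Set.range_comp]
    congr 2
    ext1 i
    exact X_pow_eq_monomial
  rw [himage, mem_ideal_span_monomial_image]
  refine forall₂_congr fun m _ => ?_
  rw [Set.exists_mem_insert, Set.exists_range_iff, not_and_or, or_comm]
  refine or_congr ?_ ?_
  · simp only [Finsupp.single_le_iff, Nat.succ_le_iff, not_forall, not_le]
  · simp [Finsupp.le_def, Nat.one_le_iff_ne_zero]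

theorem card_bounded_exponents_with_zero (σ : Type*) [Fintype σ] (r : ℕ) :
    Nat.card {m : σ →₀ ℕ // (∀ j, m j ≤ r) ∧ ∃ j, m j = 0} =
      (r + 1) ^ Fintype.card σ - r ^ Fintype.card σ := by
  classical
  let A : Finset (σ → ℕ) := Fintype.piFinset fun _ => Finset.range (r + 1)
  let B : Finset (σ → ℕ) := Fintype.piFinset fun _ => Finset.Ico 1 (r + 1)
  have hBA : B ⊆ A := Fintype.piFinset_subset _ _ fun _ x hx => by
    simp only [Finset.mem_Ico, Finset.mem_range] at hx ⊢
    exact hx.2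
  have e : {m : σ →₀ ℕ // (∀ j, m j ≤ r) ∧ ∃ j, m j = 0} ≃ {f // f ∈ A \ B} :=
    Finsupp.equivFunOnFinite.subtypeEquiv fun m => by
      simp only [A, B, Finset.mem_sdiff, Fintype.mem_piFinset, Finset.mem_range, Finset.mem_Ico,
        Finsupp.equivFunOnFinite_apply, Nat.lt_succ_iff, not_forall]
      refine and_congr_right fun h => exists_congr fun j => ?_
      have := h j
      omega
  rw [Nat.card_congr e, Nat.card_eq_fintype_card, Fintype.card_coe,
    Finset.card_sdiff_of_subset hBA]
  simp [A, B]

/-- For `r ≥ 1`, `n ≥ 2`, with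
`I(o) = ⟨Z_1^(r+1), …, Z_n^(r+1), Z_1⋯Z_n⟩`, the quotient `ℂ[Z]/I(o)` has
`ℂ`-dimension `(r+1)^n − r^n`, and the classes of the monomials `Z^I` with all
exponents `≤ r` and at least one exponent `0` form a `ℂ`-basis. -/
theorem quotient_by_Io_basis (r n : ℕ) (hr : 1 ≤ r) (hn : 2 ≤ n) :
    let Io : Ideal (MvPolynomial (Fin n) ℂ) :=
      Ideal.span (insert (∏ i, (X i : MvPolynomial (Fin n) ℂ))
        (Set.range fun i : Fin n => (X i : MvPolynomial (Fin n) ℂ) ^ (r + 1)))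
    let fam : {I : Fin n →₀ ℕ // (∀ j, I j ≤ r) ∧ ∃ j, I j = 0} →
        MvPolynomial (Fin n) ℂ ⧸ Io :=
      fun I => Ideal.Quotient.mk Io (monomial I.1 (1 : ℂ))
    Module.finrank ℂ (MvPolynomial (Fin n) ℂ ⧸ Io) = (r + 1) ^ n - r ^ n ∧
      LinearIndependent ℂ fam ∧
      Submodule.span ℂ (Set.range fam) = ⊤ := by
  intro Io fam
  have hmem : ∀ p, p ∈ Io ↔ ∀ m ∈ p.support, ¬ ((∀ j, m j ≤ r) ∧ ∃ j, m j = 0) :=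
    mem_span_prod_X_X_pow_iff r
  have hli : LinearIndependent ℂ fam := linearIndependent_mk_monomial hmem
  have hspan : Submodule.span ℂ (Set.range fam) = ⊤ := by
    refine span_range_mk_monomial fun m hm => (hmem _).mpr fun m' hm' => ?_
    rwa [Finset.mem_singleton.mp (support_monomial_subset hm')]
  refine ⟨?_, hli, hspan⟩
  rw [Module.finrank_eq_nat_card_basis (Module.Basis.mk hli hspan.ge),
    card_bounded_exponents_with_zero, Fintype.card_fin]
end

section
/- Let n ≥ 2 and let G = A_1(n), the group of diagonal n×n matrices with entries ±1 and determinant 1, act on ℂ[Z_1,…,Z_n] by g·Z_i = g_{ii} Z_i, and let I(o) = ⟨Z_1^2, …, Z_n^2, Z_1⋯Z_n⟩. Then in the G-module ℂ[Z_1,…,Z_n]/I(o), the isotypic component of the trivial character of G has dimension 1, and for every non-trivial character ρ of G the ρ-isotypic component has dimension 2, with a basis given by the classes of the two monomials Z^I and Z^{I'} whose exponent vectors I, I' have entries in {0,1} and satisfy i_s + i'_s = 1 for all 1 ≤ s ≤ n. -/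
open MvPolynomial

noncomputable section

/-- The abelian group `A_r(n)`: diagonal matrices (encoded as tuples of units)
`d` with `d i ^ (r+1) = 1` for all `i` and `∏ i, d i = 1` (determinant one). -/
def ArGroup (r n : ℕ) : Subgroup (Fin n → ℂˣ) where
  carrier := {d | (∀ i, d i ^ (r + 1) = 1) ∧ ∏ i, d i = 1}
  one_mem' := ⟨fun _ => one_pow _, Finset.prod_const_one⟩
  mul_mem' := by
    rintro a b ⟨ha1, ha2⟩ ⟨hb1, hb2⟩
    refine ⟨fun i => ?_, ?_⟩
    · simp [Pi.mul_apply, mul_pow, ha1 i, hb1 i]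
    · simp [Finset.prod_mul_distrib, ha2, hb2]
  inv_mem' := by
    rintro a ⟨ha1, ha2⟩
    refine ⟨fun i => ?_, ?_⟩
    · rw [Pi.inv_apply, inv_pow, ha1 i, inv_one]
    · simp [Finset.prod_inv_distrib, ha2]

/-- The action of a diagonal element `d` on polynomials, `Z i ↦ d i • Z i`. -/
def actA {n : ℕ} (d : Fin n → ℂˣ) :
    MvPolynomial (Fin n) ℂ →ₐ[ℂ] MvPolynomial (Fin n) ℂ :=
  aeval fun i => C (d i : ℂ) * X i

/-- The `ρ`-isotypic component (as a set) of the `A_r(n)`-module `ℂ[Z]/I`: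
those classes `w` such that for every `g` in the group and every representative `p`
of `w`, the class of `g · p` equals `ρ(g) • w`. -/
def iso (r n : ℕ) (I : Ideal (MvPolynomial (Fin n) ℂ)) (ρ : ArGroup r n →* ℂˣ) :
    Set (MvPolynomial (Fin n) ℂ ⧸ I) :=
  {w | ∀ g : ArGroup r n, ∀ p, Ideal.Quotient.mk I p = w →
    Ideal.Quotient.mk I (actA (g : Fin n → ℂˣ) p) = (ρ g : ℂ) • w}

end

/-- The weight of the monomial with exponent vector `m` at the diagonal element `d`. -/
noncomputable def monomialWeight {n : ℕ} (d : Fin n → ℂˣ) (m : Fin n → ℕ) : ℂ :=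
  ∏ i, (d i : ℂ) ^ m i

theorem monomialWeight_add {n : ℕ} (d : Fin n → ℂˣ) (m k : Fin n → ℕ) :
    monomialWeight d (m + k) = monomialWeight d m * monomialWeight d k := by
  simp [monomialWeight, pow_add, Finset.prod_mul_distrib]

theorem actA_monomial {n : ℕ} (d : Fin n → ℂˣ) (m : Fin n →₀ ℕ) (c : ℂ) :
    actA d (monomial m c) = monomialWeight d m • monomial m c := by
  have hm : monomial m c = C c * ∏ i, (X i : MvPolynomial (Fin n) ℂ) ^ m i := by
    rw [monomial_eq, Finsupp.prod_fintype _ _ fun i => pow_zero _]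
  rw [hm, smul_eq_C_mul, monomialWeight]
  simp only [actA, map_mul, map_prod, map_pow, aeval_X, mul_pow, Finset.prod_mul_distrib, algHom_C,
    algebraMap_eq]
  ring

theorem coeff_actA {n : ℕ} (d : Fin n → ℂˣ) (m : Fin n →₀ ℕ) (p : MvPolynomial (Fin n) ℂ) :
    coeff m (actA d p) = monomialWeight d m * coeff m p := by
  induction p using MvPolynomial.induction_on' with
  | monomial k c =>
    rw [actA_monomial, coeff_smul, coeff_monomial, smul_eq_mul]
    split_ifs with h
    · rw [h]
    · simp
  | add p q hp hq => rw [map_add, coeff_add, coeff_add, hp, hq, mul_add]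

/-- The ideal `⟨Z_1 ⋯ Z_n, Z_1 ^ 2, …, Z_n ^ 2⟩`. -/
noncomputable abbrev squaresProdIdeal (n : ℕ) : Ideal (MvPolynomial (Fin n) ℂ) :=
  Ideal.span (insert (∏ i, (X i : MvPolynomial (Fin n) ℂ))
    (Set.range fun i : Fin n => (X i : MvPolynomial (Fin n) ℂ) ^ 2))

theorem mem_squaresProdIdeal {n : ℕ} (p : MvPolynomial (Fin n) ℂ) :
    p ∈ squaresProdIdeal n ↔
      ∀ m : Fin n →₀ ℕ, (∀ i, m i ≤ 1) → (∃ i, m i = 0) → coeff m p = 0 := by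
  have hgen : insert (∏ i, (X i : MvPolynomial (Fin n) ℂ))
      (Set.range fun i : Fin n => (X i : MvPolynomial (Fin n) ℂ) ^ 2) =
      (fun s => monomial s (1 : ℂ)) ''
        insert (∑ i, Finsupp.single i 1) (Set.range fun i : Fin n => Finsupp.single i 2) := by
    rw [Set.image_insert_eq, ← Set.range_comp, monomial_sum_one]
    simp only [X, Function.comp_def, monomial_pow, one_pow, Finsupp.smul_single, smul_eq_mul,
      mul_one]
  have hsum (m : Fin n →₀ ℕ) : ∑ i, Finsupp.single i 1 ≤ m ↔ ∀ i, 1 ≤ m i := by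
    refine forall_congr' fun i => ?_
    simp [Finsupp.finsetSum_apply, Finsupp.single_apply]
  rw [squaresProdIdeal, hgen, mem_ideal_span_monomial_image]
  simp only [Set.mem_insert_iff, Set.mem_range, exists_eq_or_imp, exists_exists_eq_and, hsum,
    Finsupp.single_le_iff, mem_support_iff]
  refine forall_congr' fun m => ?_
  constructor
  · rintro h hle ⟨i, hi⟩
    by_contra hc
    rcases h hc with h | ⟨j, hj⟩
    · have := h i
      omega
    · have := hle j
      omega
  · intro h hc
    by_contra! hcon
    obtain ⟨⟨i, hi⟩, hlt⟩ := hcon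
    exact hc (h (fun j => by have := hlt j; omega) ⟨i, by omega⟩)

theorem mk_mem_iso {n : ℕ} (ρ : ArGroup 1 n →* ℂˣ) (p : MvPolynomial (Fin n) ℂ) :
    Ideal.Quotient.mk (squaresProdIdeal n) p ∈ iso 1 n (squaresProdIdeal n) ρ ↔
      ∀ (g : ArGroup 1 n) (m : Fin n →₀ ℕ), (∀ i, m i ≤ 1) → (∃ i, m i = 0) →
        coeff m p ≠ 0 → monomialWeight g m = ρ g := by
  have key (g : ArGroup 1 n) (q : MvPolynomial (Fin n) ℂ) :
      Ideal.Quotient.mk (squaresProdIdeal n) (actA g q) =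
          (ρ g : ℂ) • Ideal.Quotient.mk (squaresProdIdeal n) q ↔
        ∀ m : Fin n →₀ ℕ, (∀ i, m i ≤ 1) → (∃ i, m i = 0) →
          coeff m q ≠ 0 → monomialWeight g m = ρ g := by
    have hs : (ρ g : ℂ) • Ideal.Quotient.mk (squaresProdIdeal n) q =
      Ideal.Quotient.mk (squaresProdIdeal n) ((ρ g : ℂ) • q) := rfl
    rw [hs, Ideal.Quotient.eq, mem_squaresProdIdeal]
    refine forall₃_congr fun m _ _ => ?_
    rw [coeff_sub, coeff_actA, coeff_smul, smul_eq_mul, ← sub_mul, mul_eq_zero, sub_eq_zero]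
    tauto
  constructor
  · intro h g
    exact (key g p).1 (h g p rfl)
  · intro h g q hq
    rw [← hq, key]
    intro m h1 h0 hc
    refine h g m h1 h0 ?_
    rw [Ideal.Quotient.eq, mem_squaresProdIdeal] at hq
    have hqp := hq m h1 h0
    rw [coeff_sub, sub_eq_zero] at hqp
    rwa [← hqp]

theorem coe_eq_one_or_neg_one {n : ℕ} (g : ArGroup 1 n) (i : Fin n) :
    (g : Fin n → ℂˣ) i = 1 ∨ (g : Fin n → ℂˣ) i = -1 := by
  exact Units.eq_or_eq_neg_of_sq_eq_sq _ _ ((g.2.1 i).trans (one_pow 2).symm)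

theorem exists_monomialWeight_ne {n : ℕ} {k m : Fin n → ℕ} (hk : ∀ i, k i ≤ 1)
    (hm : ∀ i, m i ≤ 1) (hne : ∃ i, k i ≠ m i) (hadd : ∃ j, k j + m j ≠ 1) :
    ∃ g : ArGroup 1 n, monomialWeight g k ≠ monomialWeight g m := by
  obtain ⟨i, hi⟩ := hne
  obtain ⟨j, hj⟩ := hadd
  have hkj : k j = m j := by
    have := hk j; have := hm j; omega
  have hw (l : Fin n → ℕ) : monomialWeight (Pi.mulSingle i (-1) * Pi.mulSingle j (-1)) l =
      (-1) ^ l i * (-1) ^ l j := by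
    have hs (a : Fin n) :
        ∏ b, ((Pi.mulSingle a (-1) : Fin n → ℂˣ) b : ℂ) ^ l b = (-1) ^ l a := by
      rw [Fintype.prod_eq_single a fun b hb => by rw [Pi.mulSingle_eq_of_ne hb]; simp]
      simp
    simp only [monomialWeight, Pi.mul_apply, Units.val_mul, mul_pow, Finset.prod_mul_distrib, hs]
  refine ⟨⟨Pi.mulSingle i (-1) * Pi.mulSingle j (-1), fun a => ?_, ?_⟩, ?_⟩
  · rw [Pi.mul_apply, mul_pow, Pi.mulSingle_apply, Pi.mulSingle_apply]
    split_ifs <;> simp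
  · simp [Finset.prod_mul_distrib]
  · rw [hw, hw, hkj]
    have := hk i
    have := hm i
    rw [Ne, mul_left_inj' (by simp)]
    interval_cases k i <;> interval_cases m i <;> first | exact absurd rfl hi | norm_num

/-- Sign vectors of length `n` map onto `A_1(n)` by correcting the entry at `i₀`. -/
noncomputable def signVectorHom {n : ℕ} (i₀ : Fin n) : (Fin n → ℤˣ) →* ArGroup 1 n where
  toFun d := ⟨fun i => Units.map (Int.castRingHom ℂ : ℤ →* ℂ)
    (d i * (Pi.mulSingle i₀ (∏ j, d j) : Fin n → ℤˣ) i), by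
    refine ⟨fun i => ?_, ?_⟩
    · rw [← map_pow, Int.units_sq, map_one]
    · rw [← map_prod, Finset.prod_mul_distrib, Fintype.prod_pi_mulSingle', ← sq, Int.units_sq,
        map_one]⟩
  map_one' := by
    ext i
    simp
  map_mul' d e := by
    ext i
    simp only [Pi.mul_apply, Finset.prod_mul_distrib, Pi.mulSingle_mul, Subgroup.coe_mul, map_mul]
    push_cast
    ring

theorem exists_monomialWeight_eq {n : ℕ} (hn : 0 < n) (ρ : ArGroup 1 n →* ℂˣ) :
    ∃ m : Fin n → ℕ, (∀ i, m i ≤ 1) ∧ ∀ g : ArGroup 1 n, monomialWeight g m = ρ g := by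
  classical
  let φ := ρ.comp (signVectorHom (⟨0, hn⟩ : Fin n))
  refine ⟨fun i => if φ (Pi.mulSingle i (-1)) = 1 then 0 else 1, fun i => ?_, fun g => ?_⟩
  · dsimp only
    split_ifs <;> simp
  let d : Fin n → ℤˣ := fun i => if (g : Fin n → ℂˣ) i = 1 then 1 else -1
  have hd (i : Fin n) : Units.map (Int.castRingHom ℂ) (d i) = (g : Fin n → ℂˣ) i := by
    rcases coe_eq_one_or_neg_one g i with h | h
    · simp [d, h]
    · have : (-1 : ℂˣ) ≠ 1 := fun h => by
        have := congrArg Units.val h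
        norm_num at this
      ext
      simp [d, h, this]
  have hprod : ∏ i, d i = 1 := by
    apply Units.map_injective (f := (Int.castRingHom ℂ : ℤ →* ℂ)) Int.cast_injective
    rw [map_prod, map_one, ← g.2.2]
    exact Finset.prod_congr rfl fun i _ => hd i
  have hg : signVectorHom ⟨0, hn⟩ d = g := by
    apply Subtype.ext
    funext i
    rw [← hd]
    simp [signVectorHom, hprod]
  have hρ : ρ g = ∏ i, φ (Pi.mulSingle i (d i)) := by
    rw [← map_prod, Finset.univ_prod_mulSingle, MonoidHom.comp_apply, hg]
  have hφ (i : Fin n) : φ (Pi.mulSingle i (-1)) = 1 ∨ φ (Pi.mulSingle i (-1)) = -1 := by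
    refine Units.eq_or_eq_neg_of_sq_eq_sq _ _ ?_
    rw [← map_pow, ← Pi.mulSingle_pow]
    simp
  rw [hρ, monomialWeight, Units.coe_prod]
  refine Finset.prod_congr rfl fun i _ => ?_
  rw [← hd]
  rcases Int.units_eq_one_or (d i) with h | h
  · simp [h]
  · rw [h]
    split_ifs with h1
    · simp [h1]
    · rw [(hφ i).resolve_left h1]
      simp

theorem monomialWeight_eq_of_add_eq_one {n : ℕ} {m k : Fin n → ℕ} (h : ∀ i, m i + k i = 1)
    (g : ArGroup 1 n) : monomialWeight g k = monomialWeight g m := by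
  have hmk : monomialWeight g m * monomialWeight g k = 1 := by
    rw [← monomialWeight_add, monomialWeight]
    simp only [Pi.add_apply, h, pow_one]
    rw [← Units.coe_prod, g.2.2, Units.val_one]
  have hmm : monomialWeight g m * monomialWeight g m = 1 := by
    rw [monomialWeight, ← Finset.prod_mul_distrib]
    refine Finset.prod_eq_one fun i _ => ?_
    rw [← mul_pow]
    rcases coe_eq_one_or_neg_one g i with h | h <;> simp [h]
  exact mul_left_cancel₀ (left_ne_zero_of_mul_eq_one hmk) (hmk.trans hmm.symm)

theorem mk_monomial_mem_iso {n : ℕ} {ρ : ArGroup 1 n →* ℂˣ} {m : Fin n →₀ ℕ}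
    (hm : ∀ g : ArGroup 1 n, monomialWeight g m = ρ g) :
    Ideal.Quotient.mk (squaresProdIdeal n) (monomial m 1) ∈ iso 1 n (squaresProdIdeal n) ρ := by
  rw [mk_mem_iso]
  intro g k _ _ hc
  rw [coeff_monomial] at hc
  split_ifs at hc with h
  · rw [← h, hm]
  · exact absurd rfl hc

theorem exists_eq_smul_add_smul_of_mem_iso {n : ℕ} {ρ : ArGroup 1 n →* ℂˣ} {m m' : Fin n →₀ ℕ}
    (hadd : ∀ i, m i + m' i = 1) (hm : ∀ g : ArGroup 1 n, monomialWeight g m = ρ g)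
    {w : MvPolynomial (Fin n) ℂ ⧸ squaresProdIdeal n}
    (hw : w ∈ iso 1 n (squaresProdIdeal n) ρ) :
    ∃ a b : ℂ, w = a • Ideal.Quotient.mk (squaresProdIdeal n) (monomial m 1) +
      b • Ideal.Quotient.mk (squaresProdIdeal n) (monomial m' 1) := by
  obtain ⟨p, rfl⟩ := Ideal.Quotient.mk_surjective w
  rcases Nat.eq_zero_or_pos n with rfl | hn
  · refine ⟨coeff 0 p, 0, ?_⟩
    rw [zero_smul, add_zero]
    change _ = Ideal.Quotient.mk (squaresProdIdeal 0) (coeff 0 p • monomial m 1)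
    rw [Ideal.Quotient.eq, mem_squaresProdIdeal]
    rintro k _ ⟨i, _⟩
    exact i.elim0
  refine ⟨coeff m p, coeff m' p, ?_⟩
  change _ = Ideal.Quotient.mk (squaresProdIdeal n)
    (coeff m p • monomial m 1 + coeff m' p • monomial m' 1)
  have hne : m ≠ m' := by
    rintro rfl
    have := hadd ⟨0, hn⟩
    omega
  rw [Ideal.Quotient.eq, mem_squaresProdIdeal]
  intro k hk h0
  simp only [coeff_sub, coeff_add, coeff_smul, coeff_monomial, smul_eq_mul]
  by_cases h1 : m = k
  · subst h1
    simp [hne.symm]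
  by_cases h2 : m' = k
  · subst h2
    simp [hne]
  rw [if_neg h1, if_neg h2, mul_zero, mul_zero, add_zero, sub_zero]
  by_contra hc
  obtain ⟨g, hg⟩ := exists_monomialWeight_ne (m := m) hk (fun i => by have := hadd i; omega)
    (by
      by_contra! h
      exact h1 (Finsupp.ext fun i => (h i).symm))
    (by
      by_contra! h
      exact h2 (Finsupp.ext fun i => by have := h i; have := hadd i; omega))
  exact hg (((mk_mem_iso ρ p).1 hw g k hk h0 hc).trans (hm g).symm)

theorem linearIndependent_mk_monomial_s4 {n : ℕ} {m m' : Fin n →₀ ℕ} (hne : m ≠ m')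
    (hm : ∀ i, m i ≤ 1) (hm₀ : ∃ i, m i = 0) (hm' : ∀ i, m' i ≤ 1) (hm'₀ : ∃ i, m' i = 0) :
    LinearIndependent ℂ ![Ideal.Quotient.mk (squaresProdIdeal n) (monomial m 1),
      Ideal.Quotient.mk (squaresProdIdeal n) (monomial m' 1)] := by
  rw [LinearIndependent.pair_iff]
  intro a b hab
  change Ideal.Quotient.mk (squaresProdIdeal n) (a • monomial m 1 + b • monomial m' 1) = 0 at hab
  rw [Ideal.Quotient.eq_zero_iff_mem, mem_squaresProdIdeal] at hab
  have h1 := hab m hm hm₀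
  have h2 := hab m' hm' hm'₀
  simp only [coeff_add, coeff_smul, coeff_monomial, smul_eq_mul] at h1 h2
  simp only [hne, hne.symm, if_true, if_false, mul_one, mul_zero, add_zero, zero_add] at h1 h2
  exact ⟨h1, h2⟩

/-- For `G = A_1(n)` acting on `ℂ[Z_1,…,Z_n]/I(o)` with
`I(o) = ⟨Z_1^2, …, Z_n^2, Z_1⋯Z_n⟩`: the isotypic component of the trivial
character has dimension `1`, and for every non-trivial character `ρ` the
`ρ`-isotypic component has dimension `2`, with a basis the classes of the two
monomials `Z^I`, `Z^I'` with exponents in `{0,1}` and `I s + I' s = 1` for all `s`. -/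
theorem A1n_isotypic_components (n : ℕ) (hn : 2 ≤ n) :
    let Io : Ideal (MvPolynomial (Fin n) ℂ) :=
      Ideal.span (insert (∏ i, (X i : MvPolynomial (Fin n) ℂ))
        (Set.range fun i : Fin n => (X i : MvPolynomial (Fin n) ℂ) ^ 2))
    (∃ w ∈ iso 1 n Io 1, w ≠ 0 ∧ ∀ w' ∈ iso 1 n Io 1, ∃ a : ℂ, w' = a • w) ∧
    ∀ ρ : ArGroup 1 n →* ℂˣ, ρ ≠ 1 →
      ∃ I I' : Fin n → ℕ, (∀ s, I s ≤ 1) ∧ (∀ s, I' s ≤ 1) ∧ (∀ s, I s + I' s = 1) ∧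
        Ideal.Quotient.mk Io (monomial (Finsupp.equivFunOnFinite.symm I) (1 : ℂ)) ∈
          iso 1 n Io ρ ∧
        Ideal.Quotient.mk Io (monomial (Finsupp.equivFunOnFinite.symm I') (1 : ℂ)) ∈
          iso 1 n Io ρ ∧
        LinearIndependent ℂ
          ![Ideal.Quotient.mk Io (monomial (Finsupp.equivFunOnFinite.symm I) (1 : ℂ)),
            Ideal.Quotient.mk Io (monomial (Finsupp.equivFunOnFinite.symm I') (1 : ℂ))] ∧
        ∀ w ∈ iso 1 n Io ρ, ∃ a b : ℂ,
          w = a • Ideal.Quotient.mk Io (monomial (Finsupp.equivFunOnFinite.symm I) (1 : ℂ)) +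
              b • Ideal.Quotient.mk Io (monomial (Finsupp.equivFunOnFinite.symm I') (1 : ℂ)) := by
  intro Io
  refine ⟨⟨Ideal.Quotient.mk Io (monomial 0 1), ?_, ?_, ?_⟩, fun ρ hρ => ?_⟩
  · exact mk_monomial_mem_iso fun g => by simp [monomialWeight]
  · rw [Ne, Ideal.Quotient.eq_zero_iff_mem]
    intro h
    simpa using (mem_squaresProdIdeal _).1 h 0 (by simp) ⟨⟨0, by omega⟩, rfl⟩
  · intro w hw
    obtain ⟨a, b, h⟩ := exists_eq_smul_add_smul_of_mem_iso (m := 0)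
      (m' := Finsupp.equivFunOnFinite.symm fun _ => 1) (by simp)
      (fun g => by simp [monomialWeight]) hw
    refine ⟨a, h.trans ?_⟩
    rw [(Ideal.Quotient.eq_zero_iff_mem (I := squaresProdIdeal n)
      (a := monomial (Finsupp.equivFunOnFinite.symm fun _ => 1) 1)).2, smul_zero, add_zero]
    rw [mem_squaresProdIdeal]
    rintro k _ ⟨i, hi⟩
    rw [coeff_monomial, if_neg]
    rintro rfl
    simp at hi
  · obtain ⟨m, hm, hmρ⟩ := exists_monomialWeight_eq (by omega) ρ
    have hadd (i : Fin n) : m i + (1 - m i) = 1 := by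
      have := hm i
      omega
    have hm'ρ (g : ArGroup 1 n) : monomialWeight g (fun i => 1 - m i) = ρ g :=
      (monomialWeight_eq_of_add_eq_one hadd g).trans (hmρ g)
    have exists_ne_zero {k : Fin n → ℕ} (hk : ∀ g : ArGroup 1 n, monomialWeight g k = ρ g) :
        ∃ i, k i ≠ 0 := by
      by_contra! h
      refine hρ (MonoidHom.ext fun g => Units.ext ?_)
      rw [← hk]
      simp [monomialWeight, h]
    obtain ⟨i, hi⟩ := exists_ne_zero hmρ
    obtain ⟨j, hj⟩ := exists_ne_zero hm'ρ
    refine ⟨m, fun i => 1 - m i, hm, fun i => Nat.sub_le _ _, hadd, mk_monomial_mem_iso hmρ,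
      mk_monomial_mem_iso hm'ρ, linearIndependent_mk_monomial_s4 ?_ hm ⟨j, ?_⟩
        (fun i => Nat.sub_le _ _) ⟨i, ?_⟩,
      fun w hw => exists_eq_smul_add_smul_of_mem_iso hadd hmρ hw⟩
    · intro h
      have := DFunLike.congr_fun h i
      simp only [Finsupp.equivFunOnFinite_symm_apply_apply] at this
      omega
    · simp only [Finsupp.equivFunOnFinite_symm_apply_apply]
      omega
    · simp only [Finsupp.equivFunOnFinite_symm_apply_apply]
      have := hm i
      omega
end

section
/- Let r ≥ 1 and let the cyclic group μ_{r+1} of (r+1)-th roots of unity act on ℂ[Z_1, Z_2] by ε·Z_1 = εZ_1, ε·Z_2 = ε^{-1}Z_2. For each 0 ≤ k ≤ r, the ideal I(ô_k) = ⟨Z_1^{k+1}, Z_2^{r+1-k}, Z_1 Z_2⟩ is invariant under this action, the quotient ℂ[Z_1,Z_2]/I(ô_k) has dimension r+1 with basis the classes of 1, Z_1, …, Z_1^k, Z_2, …, Z_2^{r-k}, and this quotient is isomorphic to the regular representation of μ_{r+1}, i.e. every character ε ↦ ε^m (0 ≤ m ≤ r) of μ_{r+1} occurs in it with multiplicity exactly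 one. -/
open MvPolynomial

noncomputable section

/-- The action of an `(r+1)`-st root of unity `ε` on `ℂ[Z_1, Z_2]`:
`Z_1 ↦ ε Z_1`, `Z_2 ↦ ε⁻¹ Z_2`. -/
def actM (ε : ℂ) : MvPolynomial (Fin 2) ℂ →ₐ[ℂ] MvPolynomial (Fin 2) ℂ :=
  aeval ![C ε * X 0, C ε⁻¹ * X 1]

/-- The isotypic component (as a set) of the character `ε ↦ ε^m` of `μ_{r+1}`
in the module `ℂ[Z_1,Z_2]/I`. -/
def isoM (r m : ℕ) (I : Ideal (MvPolynomial (Fin 2) ℂ)) :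
    Set (MvPolynomial (Fin 2) ℂ ⧸ I) :=
  {w | ∀ ε : ℂ, ε ^ (r + 1) = 1 → ∀ p, Ideal.Quotient.mk I p = w →
    Ideal.Quotient.mk I (actM ε p) = ε ^ m • w}

end

section MonomialQuotient

variable {σ ι K : Type*} [Field K] {S : Set (σ →₀ ℕ)} {e : ι → σ →₀ ℕ}

/-- The monomials outside a monomial ideal are linearly independent modulo it. -/
theorem linearIndependent_mk_monomial_s5 (he : Function.Injective e)
    (hS : ∀ i, ¬ ∃ s ∈ S, s ≤ e i) :
    LinearIndependent K fun i =>
      Ideal.Quotient.mk (Ideal.span ((fun s => monomial s (1 : K)) '' S)) (monomial (e i) 1) := by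
  classical
  rw [linearIndependent_iff']
  intro t c hc i hi
  have hmem : ∑ j ∈ t, monomial (e j) (c j) ∈
      Ideal.span ((fun s => monomial s (1 : K)) '' S) := by
    rw [← Ideal.Quotient.eq_zero_iff_mem, ← hc, map_sum]
    refine Finset.sum_congr rfl fun j _ => ?_
    rw [← Ideal.Quotient.mkₐ_eq_mk K, ← map_smul, smul_monomial, smul_eq_mul, mul_one]
  rw [mem_ideal_span_monomial_image] at hmem
  by_contra hci
  refine hS i (hmem (e i) ?_)
  rw [mem_support_iff, coeff_sum]
  simpa [coeff_monomial, he.eq_iff, hi] using hci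

/-- The monomials outside a monomial ideal span the quotient by it. -/
theorem span_mk_monomial_eq_top (hS : ∀ d, (∃ s ∈ S, s ≤ d) ∨ d ∈ Set.range e) :
    Submodule.span K (Set.range fun i =>
      Ideal.Quotient.mk (Ideal.span ((fun s => monomial s (1 : K)) '' S))
        (monomial (e i) 1)) = ⊤ := by
  classical
  rw [eq_top_iff]
  rintro w -
  obtain ⟨p, rfl⟩ := Ideal.Quotient.mk_surjective w
  induction p using MvPolynomial.induction_on' with
  | add p q hp hq => rw [map_add]; exact add_mem hp hq
  | monomial d a =>
    rcases hS d with ⟨s, hs, hsd⟩ | ⟨i, rfl⟩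
    · convert Submodule.zero_mem _
      rw [Ideal.Quotient.eq_zero_iff_mem, mem_ideal_span_monomial_image]
      intro x hx
      rw [Finset.mem_singleton.1 (support_monomial_subset hx)]
      exact ⟨s, hs, hsd⟩
    · rw [← mul_one a, ← smul_eq_mul, ← smul_monomial, ← Ideal.Quotient.mkₐ_eq_mk K, map_smul]
      exact Submodule.smul_mem _ _ (Submodule.subset_span ⟨i, rfl⟩)

end MonomialQuotient

theorem actM_X_zero_pow (ε : ℂ) (n : ℕ) :
    actM ε (X 0 ^ n) = ε ^ n • (X 0 ^ n : MvPolynomial (Fin 2) ℂ) := by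
  simp [actM, mul_pow, smul_eq_C_mul]

theorem actM_X_one_pow (ε : ℂ) (n : ℕ) :
    actM ε (X 1 ^ n) = (ε⁻¹) ^ n • (X 1 ^ n : MvPolynomial (Fin 2) ℂ) := by
  rw [smul_eq_C_mul, map_pow C]
  simp [actM, mul_pow]

theorem actM_X_zero_mul_X_one (ε : ℂ) :
    actM ε (X 0 * X 1) = (ε * ε⁻¹) • (X 0 * X 1 : MvPolynomial (Fin 2) ℂ) := by
  simp only [actM, smul_eq_C_mul, map_mul, aeval_X, Matrix.cons_val_zero, Matrix.cons_val_one]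
  ring

/-- If an invariant ideal has a basis of weight vectors modulo it, whose weights run through
`0, …, r` without repetition, then each character has multiplicity one in the quotient. -/
theorem exists_generator_isoM {ι : Type*} [Fintype ι] {r : ℕ}
    {I : Ideal (MvPolynomial (Fin 2) ℂ)}
    (hI : ∀ ε : ℂ, ε ^ (r + 1) = 1 → ∀ p ∈ I, actM ε p ∈ I)
    (q : ι → MvPolynomial (Fin 2) ℂ)
    (hli : LinearIndependent ℂ fun i => Ideal.Quotient.mk I (q i))
    (hsp : Submodule.span ℂ (Set.range fun i => Ideal.Quotient.mk I (q i)) = ⊤)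
    (wt : ι → ℕ) (hwt : Function.Injective wt) (hlt : ∀ i, wt i < r + 1)
    (hact : ∀ ε : ℂ, ε ^ (r + 1) = 1 → ∀ i, actM ε (q i) = ε ^ wt i • q i) (i₀ : ι) :
    ∃ w ∈ isoM r (wt i₀) I, w ≠ 0 ∧ ∀ w' ∈ isoM r (wt i₀) I, ∃ a : ℂ, w' = a • w := by
  classical
  have mk_smul (a : ℂ) (p) : Ideal.Quotient.mk I (a • p) = a • Ideal.Quotient.mk I p :=
    map_smul (Ideal.Quotient.mkₐ ℂ I) a p
  refine ⟨Ideal.Quotient.mk I (q i₀), ?_, hli.ne_zero i₀, ?_⟩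
  · intro ε hε p hp
    rw [← mk_smul, ← hact ε hε, Ideal.Quotient.eq, ← map_sub]
    exact hI ε hε _ (Ideal.Quotient.eq.1 hp)
  · intro w' hw'
    obtain ⟨c, rfl⟩ := (Submodule.mem_span_range_iff_exists_fun ℂ).1
      (hsp ▸ Submodule.mem_top : w' ∈ _)
    have hζ := Complex.isPrimitiveRoot_exp (r + 1) r.succ_ne_zero
    set ζ := Complex.exp (2 * Real.pi * Complex.I / (r + 1 : ℕ))
    have key := hw' ζ hζ.pow_eq_one (∑ i, c i • q i) (by simp only [map_sum, mk_smul])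
    simp only [map_sum, map_smul, hact ζ hζ.pow_eq_one, mk_smul, Finset.smul_sum] at key
    rw [← sub_eq_zero, ← Finset.sum_sub_distrib] at key
    have hc := Fintype.linearIndependent_iff.1 hli
      (fun i => c i * ζ ^ wt i - ζ ^ wt i₀ * c i) (by simpa only [sub_smul, mul_smul] using key)
    refine ⟨c i₀, Finset.sum_eq_single i₀ (fun i _ hi => ?_) (by simp)⟩
    have hne : ζ ^ wt i - ζ ^ wt i₀ ≠ 0 := fun h =>
      hi (hwt (hζ.pow_inj (hlt i) (hlt i₀) (sub_eq_zero.1 h)))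
    have : c i * (ζ ^ wt i - ζ ^ wt i₀) = 0 := by rw [← hc i]; ring
    rw [(mul_eq_zero.1 this).resolve_right hne, zero_smul]

/-- For `0 ≤ k ≤ r`, the ideal
`I(ô_k) = ⟨Z_1^(k+1), Z_2^(r+1−k), Z_1 Z_2⟩` is `μ_{r+1}`-invariant, the quotient
has dimension `r+1` with basis `1, Z_1, …, Z_1^k, Z_2, …, Z_2^(r−k)`, and each
character `ε ↦ ε^m` (`0 ≤ m ≤ r`) occurs in it with multiplicity exactly one. -/
theorem mu_quotient_at_ok_is_regular (r k : ℕ) (hr : 1 ≤ r) (hk : k ≤ r) :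
    let I : Ideal (MvPolynomial (Fin 2) ℂ) :=
      Ideal.span {(X 0 : MvPolynomial (Fin 2) ℂ) ^ (k + 1), X 1 ^ (r + 1 - k), X 0 * X 1}
    let fam : Fin (k + 1) ⊕ Fin (r - k) → MvPolynomial (Fin 2) ℂ ⧸ I :=
      Sum.elim (fun i => Ideal.Quotient.mk I ((X 0 : MvPolynomial (Fin 2) ℂ) ^ (i : ℕ)))
        (fun j => Ideal.Quotient.mk I ((X 1 : MvPolynomial (Fin 2) ℂ) ^ ((j : ℕ) + 1)))
    (∀ ε : ℂ, ε ^ (r + 1) = 1 → ∀ p ∈ I, actM ε p ∈ I) ∧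
    Module.finrank ℂ (MvPolynomial (Fin 2) ℂ ⧸ I) = r + 1 ∧
    LinearIndependent ℂ fam ∧
    Submodule.span ℂ (Set.range fam) = ⊤ ∧
    ∀ m : ℕ, m ≤ r →
      ∃ w ∈ isoM r m I, w ≠ 0 ∧ ∀ w' ∈ isoM r m I, ∃ a : ℂ, w' = a • w := by
  intro I fam
  have hinv : ∀ ε : ℂ, ε ^ (r + 1) = 1 → ∀ p ∈ I, actM ε p ∈ I := by
    intro ε _
    suffices I ≤ I.comap (actM ε) from this
    refine Ideal.span_le.2 ?_
    have hgen : ∀ p ∈ ({X 0 ^ (k + 1), X 1 ^ (r + 1 - k), X 0 * X 1} :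
        Set (MvPolynomial (Fin 2) ℂ)), ∀ a : ℂ, a • p ∈ I := fun p hp a =>
      Submodule.smul_of_tower_mem I a (Ideal.subset_span hp)
    rintro _ (rfl | rfl | rfl) <;> rw [SetLike.mem_coe, Ideal.mem_comap]
    · rw [actM_X_zero_pow]; exact hgen _ (by simp) _
    · rw [actM_X_one_pow]; exact hgen _ (by simp) _
    · rw [actM_X_zero_mul_X_one]; exact hgen _ (by simp) _
  let e : Fin (k + 1) ⊕ Fin (r - k) → Fin 2 →₀ ℕ :=
    Sum.elim (fun i => Finsupp.single 0 (i : ℕ)) (fun j => Finsupp.single 1 ((j : ℕ) + 1))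
  let S : Set (Fin 2 →₀ ℕ) := {Finsupp.single 0 (k + 1), Finsupp.single 1 (r + 1 - k),
    Finsupp.single 0 1 + Finsupp.single 1 1}
  have hIS : I = Ideal.span ((fun s => monomial s (1 : ℂ)) '' S) := by
    simp only [I, S, Set.image_insert_eq, Set.image_singleton, X_pow_eq_monomial]
    simp only [X, monomial_mul, mul_one]
  have hdom (d : Fin 2 →₀ ℕ) :
      (∃ s ∈ S, s ≤ d) ↔ k + 1 ≤ d 0 ∨ r + 1 - k ≤ d 1 ∨ 1 ≤ d 0 ∧ 1 ≤ d 1 := by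
    simp [S, Finsupp.le_def, Fin.forall_fin_two]
  have he : Function.Injective e := by
    intro i j h
    have h0 := DFunLike.congr_fun h 0
    have h1 := DFunLike.congr_fun h 1
    rcases i with i | i <;> rcases j with j | j <;> simp [e] at h0 h1 <;>
      simp [Fin.ext_iff, h0, h1]
  have hqe : fam = fun i => Ideal.Quotient.mk I (monomial (e i) 1) := by
    funext i
    rcases i with i | i <;> simp [fam, e, X_pow_eq_monomial]
  have hli : LinearIndependent ℂ fam := by
    rw [hqe, hIS]
    refine linearIndependent_mk_monomial_s5 he fun i => ?_
    rw [hdom]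
    rcases i with i | i <;> simp [e] <;> omega
  have hsp : Submodule.span ℂ (Set.range fam) = ⊤ := by
    rw [hqe, hIS]
    refine span_mk_monomial_eq_top fun d => ?_
    rw [hdom, or_iff_not_imp_left]
    intro hd
    by_cases h1 : d 1 = 0
    · refine ⟨Sum.inl ⟨d 0, by omega⟩, ?_⟩
      ext x; fin_cases x <;> simp [e, h1]
    · refine ⟨Sum.inr ⟨d 1 - 1, by omega⟩, ?_⟩
      ext x; fin_cases x <;> simp [e] <;> omega
  refine ⟨hinv, ?_, hli, hsp, ?_⟩
  · rw [Module.finrank_eq_card_basis (Module.Basis.mk hli hsp.ge)]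
    simp only [Fintype.card_sum, Fintype.card_fin]
    omega
  · intro m hm
    let wt : Fin (k + 1) ⊕ Fin (r - k) → ℕ := Sum.elim (fun i => i) (fun j => r - j)
    have hwt : Function.Injective wt := by
      rintro (i | i) (j | j) h <;> simp [wt] at h <;> simp [Fin.ext_iff] <;> omega
    have hlt : ∀ i, wt i < r + 1 := by
      rintro (i | i) <;> simp only [wt, Sum.elim_inl, Sum.elim_inr] <;> omega
    have hact (ε : ℂ) (hε : ε ^ (r + 1) = 1) (i) :
        actM ε (monomial (e i) 1) = ε ^ wt i • monomial (e i) 1 := by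
      rcases i with i | i
      · simpa [e, wt, X_pow_eq_monomial] using actM_X_zero_pow ε i
      · have hpow : (ε⁻¹) ^ ((i : ℕ) + 1) = ε ^ (r - i) := by
          rw [inv_pow]
          refine inv_eq_of_mul_eq_one_right ?_
          rw [← pow_add, ← hε]
          congr 1; omega
        simpa [e, wt, X_pow_eq_monomial, hpow] using actM_X_one_pow ε (i + 1)
    have hm' : ∃ i, wt i = m := by
      rcases Nat.lt_or_ge m (k + 1) with h | h
      · exact ⟨Sum.inl ⟨m, h⟩, rfl⟩
      · exact ⟨Sum.inr ⟨r - m, by omega⟩, by simp [wt]; omega⟩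
    obtain ⟨i₀, rfl⟩ := hm'
    exact exists_generator_isoM hinv (fun i => monomial (e i) 1) (hqe ▸ hli) (hqe ▸ hsp)
      wt hwt hlt hact i₀
end

section
/- Let r ≥ 1, 0 ≤ k ≤ r, and α, β ∈ ℂ. The ideal I = ⟨Z_1^{k+1} − αZ_2^{r-k}, Z_2^{r+1-k} − βZ_1^k, Z_1Z_2 − αβ⟩ of ℂ[Z_1,Z_2] is invariant under the action of μ_{r+1} given by ε·Z_1 = εZ_1, ε·Z_2 = ε^{-1}Z_2, and the classes of the monomials 1, Z_1, …, Z_1^k, Z_2, …, Z_2^{r-k} form a ℂ-basis of ℂ[Z_1,Z_2]/I; in particular ℂ[Z_1,Z_2]/I has dimension r+1 and is isomorphic to the regular representation of μ_{r+1}. -/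
open MvPolynomial

/-- The ideal `⟨Z_1^(k+1) − αZ_2^(r−k), Z_2^(r+1−k) − βZ_1^k, Z_1Z_2 − αβ⟩`. -/
noncomputable abbrev deformedIdeal (r k : ℕ) (α β : ℂ) : Ideal (MvPolynomial (Fin 2) ℂ) :=
  Ideal.span {(X 0 : MvPolynomial (Fin 2) ℂ) ^ (k + 1) - C α * X 1 ^ (r - k),
    X 1 ^ (r + 1 - k) - C β * X 0 ^ k,
    X 0 * X 1 - C (α * β)}

/-- The monomials `1, Z_1, …, Z_1^k, Z_2, …, Z_2^(r-k)`. -/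
noncomputable def basisMonomial (r k : ℕ) :
    Fin (k + 1) ⊕ Fin (r - k) → MvPolynomial (Fin 2) ℂ :=
  Sum.elim (fun i => X 0 ^ (i : ℕ)) (fun j => X 1 ^ ((j : ℕ) + 1))

/-- The exponent, between `0` and `r`, of the character by which `μ_{r+1}` acts on
`basisMonomial r k i`. -/
def weight (r k : ℕ) : Fin (k + 1) ⊕ Fin (r - k) → ℕ :=
  Sum.elim (fun i => (i : ℕ)) (fun j => r - j)

lemma weight_le {r k : ℕ} (hk : k ≤ r) (i) : weight r k i ≤ r := by
  rcases i with i | i <;> simp only [weight, Sum.elim_inl, Sum.elim_inr] <;> omega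

lemma weight_injective (r k : ℕ) : Function.Injective (weight r k) := by
  rintro (i | i) (j | j) h <;> simp only [weight, Sum.elim_inl, Sum.elim_inr] at h
  · exact congrArg _ (Fin.ext h)
  · omega
  · omega
  · exact congrArg _ (Fin.ext (by omega))

lemma exists_weight_eq {r k m : ℕ} (hm : m ≤ r) : ∃ i, weight r k i = m := by
  by_cases h : m ≤ k
  · exact ⟨.inl ⟨m, by omega⟩, rfl⟩
  · exact ⟨.inr ⟨r - m, by omega⟩, by simp only [weight, Sum.elim_inr]; omega⟩

lemma actM_X_zero (ε : ℂ) : actM ε (X 0) = C ε * X 0 := by simp [actM]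

lemma actM_X_one (ε : ℂ) : actM ε (X 1) = C ε⁻¹ * X 1 := by simp [actM]

lemma actM_C (ε a : ℂ) : actM ε (C a) = C a := by simp [actM]

lemma inv_pow_eq_of_add_eq {ε : ℂ} {n a b : ℕ} (hε : ε ^ n = 1) (h : a + b = n) :
    ε⁻¹ ^ a = ε ^ b := by
  rw [inv_pow]
  exact inv_eq_of_mul_eq_one_right (by rw [← pow_add, h, hε])

lemma actM_basisMonomial {r k : ℕ} {ε : ℂ} (hε : ε ^ (r + 1) = 1) (i) :
    actM ε (basisMonomial r k i) = C (ε ^ weight r k i) * basisMonomial r k i := by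
  rcases i with i | j
  · simp [basisMonomial, weight, actM_X_zero, mul_pow]
  · have : ε⁻¹ ^ ((j : ℕ) + 1) = ε ^ (r - j) := inv_pow_eq_of_add_eq hε (by omega)
    simp only [basisMonomial, weight, Sum.elim_inr, map_pow, actM_X_one, mul_pow, ← this]

lemma actM_mem_deformedIdeal {r k : ℕ} (α β : ℂ) (hk : k ≤ r) {ε : ℂ} (hε : ε ^ (r + 1) = 1)
    {p : MvPolynomial (Fin 2) ℂ} (hp : p ∈ deformedIdeal r k α β) :
    actM ε p ∈ deformedIdeal r k α β := by
  have hle : deformedIdeal r k α β ≤ (deformedIdeal r k α β).comap (actM ε) := by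
    refine Ideal.span_le.2 ?_
    rintro _ (rfl | rfl | rfl)
    · have h : ε⁻¹ ^ (r - k) = ε ^ (k + 1) := inv_pow_eq_of_add_eq hε (by omega)
      have : actM ε (X 0 ^ (k + 1) - C α * X 1 ^ (r - k)) =
          C (ε ^ (k + 1)) * (X 0 ^ (k + 1) - C α * X 1 ^ (r - k)) := by
        simp only [map_sub, map_mul, map_pow, actM_X_zero, actM_X_one, actM_C, mul_pow]
        rw [← map_pow C ε⁻¹, h, map_pow]
        ring
      rw [SetLike.mem_coe, Ideal.mem_comap, this]
      exact Ideal.mul_mem_left _ _ (Ideal.subset_span (by simp))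
    · have h : ε⁻¹ ^ (r + 1 - k) = ε ^ k := inv_pow_eq_of_add_eq hε (by omega)
      have : actM ε (X 1 ^ (r + 1 - k) - C β * X 0 ^ k) =
          C (ε ^ k) * (X 1 ^ (r + 1 - k) - C β * X 0 ^ k) := by
        simp only [map_sub, map_mul, map_pow, actM_X_zero, actM_X_one, actM_C, mul_pow]
        rw [← map_pow C ε⁻¹, h, map_pow]
        ring
      rw [SetLike.mem_coe, Ideal.mem_comap, this]
      exact Ideal.mul_mem_left _ _ (Ideal.subset_span (by simp))
    · have hε0 : ε ≠ 0 := by rintro rfl; simp at hε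
      have : actM ε (X 0 * X 1 - C (α * β)) = X 0 * X 1 - C (α * β) := by
        rw [map_sub, map_mul, actM_X_zero, actM_X_one, actM_C, mul_mul_mul_comm, ← map_mul C ε,
          mul_inv_cancel₀ hε0, map_one, one_mul]
      rw [SetLike.mem_coe, Ideal.mem_comap, this]
      exact Ideal.subset_span (by simp)
  exact hle hp

/-- The coefficients of the weighted cyclic shift by which `Z_1` acts. -/
def raiseCoeff (k : ℕ) (α β : ℂ) (n : ℕ) : ℂ := if n < k then 1 else if n = k then α else α * β

/-- The coefficients of the weighted cyclic shift by which `Z_2` acts. -/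
def lowerCoeff (k : ℕ) (α β : ℂ) (n : ℕ) : ℂ := if n < k then α * β else if n = k then β else 1

lemma raiseCoeff_mul_lowerCoeff (k : ℕ) (α β : ℂ) (n : ℕ) :
    raiseCoeff k α β n * lowerCoeff k α β n = α * β := by
  unfold raiseCoeff lowerCoeff
  split_ifs <;> ring

/-- The action of `Z_1` on functions on `ℤ/(r+1)`. -/
def raiseOp (r k : ℕ) (α β : ℂ) : Module.End ℂ (ZMod (r + 1) → ℂ) where
  toFun f i := raiseCoeff k α β (i - 1).val * f (i - 1)
  map_add' f g := by ext i; simp [mul_add]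
  map_smul' c f := by ext i; simp [mul_left_comm]

/-- The action of `Z_2` on functions on `ℤ/(r+1)`. -/
def lowerOp (r k : ℕ) (α β : ℂ) : Module.End ℂ (ZMod (r + 1) → ℂ) where
  toFun f i := lowerCoeff k α β i.val * f (i + 1)
  map_add' f g := by ext i; simp [mul_add]
  map_smul' c f := by ext i; simp [mul_left_comm]

lemma raiseOp_mul_lowerOp (r k : ℕ) (α β : ℂ) :
    raiseOp r k α β * lowerOp r k α β = algebraMap ℂ _ (α * β) := by
  refine LinearMap.ext fun f => funext fun i => ?_
  simp only [raiseOp, lowerOp, Module.End.mul_apply, LinearMap.coe_mk, AddHom.coe_mk,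
    sub_add_cancel, ← mul_assoc, raiseCoeff_mul_lowerCoeff]
  rfl

lemma lowerOp_mul_raiseOp (r k : ℕ) (α β : ℂ) :
    lowerOp r k α β * raiseOp r k α β = algebraMap ℂ _ (α * β) := by
  refine LinearMap.ext fun f => funext fun i => ?_
  simp only [raiseOp, lowerOp, Module.End.mul_apply, LinearMap.coe_mk, AddHom.coe_mk,
    add_sub_cancel_right, ← mul_assoc]
  rw [mul_comm (lowerCoeff _ _ _ _), raiseCoeff_mul_lowerCoeff]
  rfl

lemma raiseOp_single (r k : ℕ) (α β : ℂ) {n : ℕ} (hn : n ≤ r) :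
    raiseOp r k α β (Pi.single (n : ZMod (r + 1)) 1) =
      raiseCoeff k α β n • Pi.single ((n + 1 : ℕ) : ZMod (r + 1)) 1 := by
  ext i
  by_cases h : i = ((n + 1 : ℕ) : ZMod (r + 1))
  · subst h
    simp [raiseOp, ZMod.val_natCast_of_lt (Nat.lt_succ_of_le hn)]
  · have h' : i - 1 ≠ n := fun h' => h (by push_cast; rw [← h']; ring)
    simp only [raiseOp, LinearMap.coe_mk, AddHom.coe_mk, Pi.smul_apply, Pi.single_eq_of_ne h,
      Pi.single_eq_of_ne h', mul_zero, smul_zero]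

lemma lowerOp_single (r k : ℕ) (α β : ℂ) {n : ℕ} (hn : n ≤ r) :
    lowerOp r k α β (Pi.single ((n + 1 : ℕ) : ZMod (r + 1)) 1) =
      lowerCoeff k α β n • Pi.single (n : ZMod (r + 1)) 1 := by
  ext i
  by_cases h : i = (n : ZMod (r + 1))
  · subst h
    simp [lowerOp, ZMod.val_natCast_of_lt (Nat.lt_succ_of_le hn)]
  · have h' : i + 1 ≠ ((n + 1 : ℕ) : ZMod (r + 1)) := fun h' =>
      h (by push_cast at h'; simpa using h')
    simp only [lowerOp, LinearMap.coe_mk, AddHom.coe_mk, Pi.smul_apply, Pi.single_eq_of_ne h,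
      Pi.single_eq_of_ne h', mul_zero, smul_zero]

lemma raiseOp_pow_single {r k : ℕ} (α β : ℂ) (hk : k ≤ r) {n : ℕ} (hn : n ≤ k) :
    (raiseOp r k α β ^ n) (Pi.single 0 1) = Pi.single (n : ZMod (r + 1)) 1 := by
  induction n with
  | zero => simp
  | succ n ih =>
    rw [pow_succ', Module.End.mul_apply, ih (by omega), raiseOp_single _ _ _ _ (by omega),
      raiseCoeff, if_pos (by omega), one_smul]

lemma lowerOp_pow_single {r k : ℕ} (α β : ℂ) {n : ℕ} (hn : n ≤ r - k) :
    (lowerOp r k α β ^ n) (Pi.single 0 1) = Pi.single ((r + 1 - n : ℕ) : ZMod (r + 1)) 1 := by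
  induction n with
  | zero => simp 
  | succ n ih =>
    rw [pow_succ', Module.End.mul_apply, ih (by omega),
      show r + 1 - n = (r + 1 - (n + 1)) + 1 by omega, lowerOp_single _ _ _ _ (by omega),
      lowerCoeff, if_neg (by omega), if_neg (by omega), one_smul]

open scoped IsMulCommutative in
/-- A pair of commuting endomorphisms evaluates polynomials in two variables. -/
lemma exists_algHom_of_commute {V : Type*} [AddCommGroup V] [Module ℂ V] {S T : Module.End ℂ V}
    (h : Commute S T) :
    ∃ φ : MvPolynomial (Fin 2) ℂ →ₐ[ℂ] Module.End ℂ V, φ (X 0) = S ∧ φ (X 1) = T := by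
  have hcomm : ∀ a ∈ ({S, T} : Set (Module.End ℂ V)), ∀ b ∈ ({S, T} : Set (Module.End ℂ V)),
      a * b = b * a := by
    rintro a (rfl | rfl) b (rfl | rfl)
    exacts [rfl, h.eq, h.eq.symm, rfl]
  have := Algebra.isMulCommutative_adjoin ℂ hcomm
  let s : Algebra.adjoin ℂ {S, T} := ⟨S, Algebra.subset_adjoin (by simp)⟩
  let t : Algebra.adjoin ℂ {S, T} := ⟨T, Algebra.subset_adjoin (by simp)⟩
  exact ⟨(Subalgebra.val _).comp (aeval ![s, t]), by simp [s], by simp [t]⟩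

lemma exists_linearMap_basisMonomial {r k : ℕ} (α β : ℂ) (hk : k ≤ r) :
    ∃ ψ : (MvPolynomial (Fin 2) ℂ ⧸ deformedIdeal r k α β) →ₗ[ℂ] (ZMod (r + 1) → ℂ),
      ∀ i, ψ (Ideal.Quotient.mk _ (basisMonomial r k i)) =
        Pi.single (weight r k i : ZMod (r + 1)) 1 := by
  obtain ⟨φ, h0, h1⟩ := exists_algHom_of_commute (S := raiseOp r k α β) (T := lowerOp r k α β)
    ((raiseOp_mul_lowerOp r k α β).trans (lowerOp_mul_raiseOp r k α β).symm)
  have hC (a : ℂ) : φ (C a) = algebraMap ℂ _ a := φ.commutes a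
  let ev : MvPolynomial (Fin 2) ℂ →ₗ[ℂ] (ZMod (r + 1) → ℂ) :=
    (LinearMap.applyₗ (Pi.single 0 1)).comp φ.toLinearMap
  have ev_apply (p) : ev p = φ p (Pi.single 0 1) := rfl
  let J : Ideal (MvPolynomial (Fin 2) ℂ) :=
    { carrier := {p | ev p = 0}
      add_mem' := fun {p q} hp hq => by
        rw [Set.mem_ofPred_eq] at *
        rw [map_add, hp, hq, add_zero]
      zero_mem' := map_zero ev
      smul_mem' := fun p q hq => by
        rw [Set.mem_ofPred_eq, ev_apply] at *
        rw [smul_eq_mul, map_mul, Module.End.mul_apply, hq, map_zero] }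
  have hle : deformedIdeal r k α β ≤ J := by
    refine Ideal.span_le.2 ?_
    rintro _ (rfl | rfl | rfl) <;> change ev _ = 0 <;> rw [map_sub, sub_eq_zero, ev_apply, ev_apply]
    · rw [map_mul, map_pow, map_pow, h0, h1, hC, Module.End.mul_apply,
        lowerOp_pow_single α β le_rfl, pow_succ', Module.End.mul_apply,
        raiseOp_pow_single α β hk le_rfl, raiseOp_single _ _ _ _ hk, raiseCoeff, if_neg (by simp),
        if_pos rfl, show r + 1 - (r - k) = k + 1 by omega]
      rfl
    · rw [map_mul, map_pow, map_pow, h0, h1, hC, Module.End.mul_apply,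
        raiseOp_pow_single α β hk le_rfl, show r + 1 - k = (r - k) + 1 by omega, pow_succ',
        Module.End.mul_apply, lowerOp_pow_single α β le_rfl,
        show r + 1 - (r - k) = k + 1 by omega, lowerOp_single _ _ _ _ hk, lowerCoeff,
        if_neg (by simp), if_pos rfl]
      rfl
    · rw [map_mul, h0, h1, hC, raiseOp_mul_lowerOp]
  refine ⟨((deformedIdeal r k α β).restrictScalars ℂ).liftQ ev fun p hp => hle hp, ?_⟩
  rintro (i | j)
  · change ev _ = _
    simp only [basisMonomial, weight, Sum.elim_inl]
    rw [ev_apply, map_pow, h0, raiseOp_pow_single α β hk (by omega)]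
  · change ev _ = _
    simp only [basisMonomial, weight, Sum.elim_inr]
    rw [ev_apply, map_pow, h1, lowerOp_pow_single α β (by omega), Nat.add_sub_add_right]

lemma linearIndependent_basisMonomial {r k : ℕ} (α β : ℂ) (hk : k ≤ r) :
    LinearIndependent ℂ fun i =>
      Ideal.Quotient.mk (deformedIdeal r k α β) (basisMonomial r k i) := by
  obtain ⟨ψ, hψ⟩ := exists_linearMap_basisMonomial α β hk
  refine LinearIndependent.of_comp ψ ?_
  have hinj : Function.Injective fun i => (weight r k i : ZMod (r + 1)) := fun i j h => by
    refine weight_injective r k ?_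
    have := congrArg ZMod.val h
    rwa [ZMod.val_natCast_of_lt (Nat.lt_succ_of_le (weight_le hk i)),
      ZMod.val_natCast_of_lt (Nat.lt_succ_of_le (weight_le hk j))] at this
  convert (Pi.basisFun ℂ (ZMod (r + 1))).linearIndependent.comp _ hinj using 1
  ext1 i
  simp [hψ]

lemma mk_C_mul (I : Ideal (MvPolynomial (Fin 2) ℂ)) (a : ℂ) (p : MvPolynomial (Fin 2) ℂ) :
    Ideal.Quotient.mk I (C a * p) = a • Ideal.Quotient.mk I p := by
  rw [← smul_eq_C_mul]
  rfl

lemma span_eq_top_of_one_mem_of_mul_mem {I : Ideal (MvPolynomial (Fin 2) ℂ)}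
    {S : Submodule ℂ (MvPolynomial (Fin 2) ℂ ⧸ I)} (h1 : 1 ∈ S)
    (hmul : ∀ n, ∀ w ∈ S, Ideal.Quotient.mk I (X n) * w ∈ S) : S = ⊤ := by
  refine Submodule.eq_top_iff'.2 fun w => ?_
  obtain ⟨p, rfl⟩ := Ideal.Quotient.mk_surjective w
  induction p using MvPolynomial.induction_on with
  | C a =>
    have : Ideal.Quotient.mk I (C a) = a • 1 := by
      rw [← mul_one (C a), mk_C_mul, map_one]
    exact this ▸ S.smul_mem a h1
  | add p q hp hq => rw [map_add]; exact S.add_mem hp hq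
  | mul_X p n hp => rw [map_mul, mul_comm]; exact hmul n _ hp

lemma span_basisMonomial {r k : ℕ} (α β : ℂ) (hk : k ≤ r) :
    Submodule.span ℂ (Set.range fun i =>
      Ideal.Quotient.mk (deformedIdeal r k α β) (basisMonomial r k i)) = ⊤ := by
  set S := Submodule.span ℂ (Set.range fun i =>
    Ideal.Quotient.mk (deformedIdeal r k α β) (basisMonomial r k i)) with hS
  set x := Ideal.Quotient.mk (deformedIdeal r k α β) (X 0) with hx
  set y := Ideal.Quotient.mk (deformedIdeal r k α β) (X 1) with hy
  have hxk : x ^ (k + 1) = α • y ^ (r - k) := by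
    rw [hx, hy, ← map_pow, ← map_pow, ← mk_C_mul]
    exact Ideal.Quotient.eq.2 (Ideal.subset_span (by simp))
  have hyk : y ^ (r + 1 - k) = β • x ^ k := by
    rw [hx, hy, ← map_pow, ← map_pow, ← mk_C_mul]
    exact Ideal.Quotient.eq.2 (Ideal.subset_span (by simp))
  have hxy : x * y = (α * β) • 1 := by
    rw [hx, hy, ← map_mul, ← map_one (Ideal.Quotient.mk _), ← mk_C_mul, mul_one]
    exact Ideal.Quotient.eq.2 (Ideal.subset_span (by simp))
  have hxS {n : ℕ} (hn : n ≤ k) : x ^ n ∈ S :=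
    Submodule.subset_span ⟨.inl ⟨n, by omega⟩, by simp [basisMonomial, hx]⟩
  have hyS {n : ℕ} (hn : n ≤ r - k) : y ^ n ∈ S := by
    rcases n with _ | n
    · simpa using hxS (Nat.zero_le k)
    · exact Submodule.subset_span ⟨.inr ⟨n, by omega⟩, by simp [basisMonomial, hy]⟩
  have hxS' {n : ℕ} (hn : n ≤ k + 1) : x ^ n ∈ S := by
    rcases hn.eq_or_lt with rfl | hn
    · exact hxk ▸ S.smul_mem _ (hyS le_rfl)
    · exact hxS (by omega)
  have hyS' {n : ℕ} (hn : n ≤ r + 1 - k) : y ^ n ∈ S := by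
    rcases hn.eq_or_lt with rfl | hn
    · exact hyk ▸ S.smul_mem _ (hxS le_rfl)
    · exact hyS (by omega)
  have hmul (z) (h : ∀ i, z * Ideal.Quotient.mk _ (basisMonomial r k i) ∈ S) (w) (hw : w ∈ S) :
      z * w ∈ S := by
    have hle : S ≤ S.comap (LinearMap.mulLeft ℂ z) := by
      refine Submodule.span_le.2 ?_
      rintro _ ⟨i, rfl⟩
      exact h i
    exact hle hw
  refine span_eq_top_of_one_mem_of_mul_mem (by simpa using hxS (Nat.zero_le k)) fun n => ?_
  fin_cases n
  · refine hmul x ?_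
    rintro (i | j)
    · simpa [basisMonomial, ← hx, ← pow_succ'] using hxS' (n := i + 1) (by omega)
    · have : x * y ^ ((j : ℕ) + 1) = (α * β) • y ^ (j : ℕ) := by
        rw [pow_succ', ← mul_assoc, hxy, smul_mul_assoc, one_mul]
      simpa only [basisMonomial, Sum.elim_inr, map_pow, ← hy, this] using
        S.smul_mem _ (hyS (by omega))
  · refine hmul y ?_
    rintro (⟨_ | i, hi⟩ | j)
    · simpa [basisMonomial] using hyS' (n := 1) (by omega)
    · have : y * x ^ (i + 1) = (α * β) • x ^ i := by
        rw [pow_succ', ← mul_assoc, mul_comm y, hxy, smul_mul_assoc, one_mul]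
      simpa only [basisMonomial, Sum.elim_inl, map_pow, ← hx, this] using
        S.smul_mem _ (hxS (by omega))
    · simpa [basisMonomial, ← hy, ← pow_succ'] using hyS' (n := j + 1 + 1) (by omega)

lemma mk_basisMonomial_mem_isoM {r k : ℕ} (α β : ℂ) (hk : k ≤ r) (i) :
    Ideal.Quotient.mk _ (basisMonomial r k i) ∈
      isoM r (weight r k i) (deformedIdeal r k α β) := by
  intro ε hε p hp
  have h := actM_mem_deformedIdeal α β hk hε (Ideal.Quotient.eq.1 hp)
  rw [map_sub] at h
  rw [Ideal.Quotient.eq.2 h, actM_basisMonomial hε, mk_C_mul]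

lemma exists_eq_smul_of_mem_isoM {r k : ℕ} (α β : ℂ) (hk : k ≤ r) (i)
    {w : MvPolynomial (Fin 2) ℂ ⧸ deformedIdeal r k α β}
    (hw : w ∈ isoM r (weight r k i) (deformedIdeal r k α β)) :
    ∃ a : ℂ, w = a • Ideal.Quotient.mk _ (basisMonomial r k i) := by
  have hli := linearIndependent_basisMonomial α β hk
  have hw' : w ∈ Submodule.span ℂ (Set.range fun i =>
      Ideal.Quotient.mk (deformedIdeal r k α β) (basisMonomial r k i)) :=
    span_basisMonomial α β hk ▸ Submodule.mem_top
  obtain ⟨c, rfl⟩ := (Submodule.mem_span_range_iff_exists_fun ℂ).1 hw'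
  have hζ := Complex.isPrimitiveRoot_exp (r + 1) r.succ_ne_zero
  set ζ := Complex.exp (2 * Real.pi * Complex.I / ((r + 1 : ℕ) : ℂ))
  have hact : actM ζ (∑ j, C (c j) * basisMonomial r k j) =
      ∑ j, C (c j * ζ ^ weight r k j) * basisMonomial r k j := by
    simp only [map_sum, map_mul (actM ζ), actM_C, actM_basisMonomial hζ.pow_eq_one, map_mul C,
      mul_assoc]
  have key := hw ζ hζ.pow_eq_one (∑ j, C (c j) * basisMonomial r k j)
    (by simp only [map_sum, mk_C_mul])
  rw [hact, map_sum, Finset.smul_sum, ← sub_eq_zero, ← Finset.sum_sub_distrib] at key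
  simp only [mk_C_mul, smul_smul, ← sub_smul] at key
  have hc := Fintype.linearIndependent_iff.1 hli _ key
  refine ⟨c i, Finset.sum_eq_single i (fun j _ hj => ?_) (by simp)⟩
  have hne : ζ ^ weight r k j ≠ ζ ^ weight r k i := fun h =>
    hj (weight_injective r k (hζ.pow_inj (Nat.lt_succ_of_le (weight_le hk j))
      (Nat.lt_succ_of_le (weight_le hk i)) h))
  have : c j * (ζ ^ weight r k j - ζ ^ weight r k i) = 0 := by linear_combination hc j
  rw [(mul_eq_zero.1 this).resolve_right (sub_ne_zero.2 hne), zero_smul]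

/-- For `0 ≤ k ≤ r` and `α, β ∈ ℂ`, the ideal
`I = ⟨Z_1^(k+1) − αZ_2^(r−k), Z_2^(r+1−k) − βZ_1^k, Z_1Z_2 − αβ⟩` is
`μ_{r+1}`-invariant, the classes of `1, Z_1, …, Z_1^k, Z_2, …, Z_2^(r−k)` form a
`ℂ`-basis of the quotient, which has dimension `r+1` and is the regular
representation of `μ_{r+1}`. -/
theorem mu_quotient_deformed_is_regular (r k : ℕ) (α β : ℂ) (hr : 1 ≤ r) (hk : k ≤ r) :
    let I : Ideal (MvPolynomial (Fin 2) ℂ) :=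
      Ideal.span {(X 0 : MvPolynomial (Fin 2) ℂ) ^ (k + 1) - C α * X 1 ^ (r - k),
        X 1 ^ (r + 1 - k) - C β * X 0 ^ k,
        X 0 * X 1 - C (α * β)}
    let fam : Fin (k + 1) ⊕ Fin (r - k) → MvPolynomial (Fin 2) ℂ ⧸ I :=
      Sum.elim (fun i => Ideal.Quotient.mk I ((X 0 : MvPolynomial (Fin 2) ℂ) ^ (i : ℕ)))
        (fun j => Ideal.Quotient.mk I ((X 1 : MvPolynomial (Fin 2) ℂ) ^ ((j : ℕ) + 1)))
    (∀ ε : ℂ, ε ^ (r + 1) = 1 → ∀ p ∈ I, actM ε p ∈ I) ∧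
    LinearIndependent ℂ fam ∧
    Submodule.span ℂ (Set.range fam) = ⊤ ∧
    Module.finrank ℂ (MvPolynomial (Fin 2) ℂ ⧸ I) = r + 1 ∧
    ∀ m : ℕ, m ≤ r →
      ∃ w ∈ isoM r m I, w ≠ 0 ∧ ∀ w' ∈ isoM r m I, ∃ a : ℂ, w' = a • w := by
  intro I fam
  have hfam : fam = fun i => Ideal.Quotient.mk I (basisMonomial r k i) := by
    ext1 i
    rcases i with i | i <;> rfl
  have hli : LinearIndependent ℂ fam := hfam ▸ linearIndependent_basisMonomial α β hk
  have hspan : Submodule.span ℂ (Set.range fam) = ⊤ := hfam ▸ span_basisMonomial α β hk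
  refine ⟨fun ε hε p hp => actM_mem_deformedIdeal α β hk hε hp, hli, hspan, ?_, fun m hm => ?_⟩
  · rw [Module.finrank_eq_card_basis (Module.Basis.mk hli hspan.ge)]
    simp only [Fintype.card_sum, Fintype.card_fin]
    omega
  · obtain ⟨i, rfl⟩ := exists_weight_eq (k := k) hm
    exact ⟨_, mk_basisMonomial_mem_isoM α β hk i,
      (linearIndependent_basisMonomial α β hk).ne_zero i,
      fun w hw => exists_eq_smul_of_mem_isoM α β hk i hw⟩
end

section
/- Let r ≥ 1, let m_1, m_2, m_3 be non-negative integers with m_1 ≥ 1 and m_1 + m_2 + m_3 = r+1, and let α_1, α_2, α_3 ∈ ℂ. The ideal I of ℂ[Z_1,Z_2,Z_3] generated by Z_1^{r+2-m_1} − α_1(Z_2Z_3)^{m_1-1}, Z_2^{r+1-m_2} − α_2(Z_3Z_1)^{m_2}, Z_3^{r+1-m_3} − α_3(Z_1Z_2)^{m_3}, (Z_1Z_2)^{m_3+1} − α_1α_2 Z_3^{r-m_3}, (Z_2Z_3)^{m_1} − α_2α_3 Z_1^{r+1-m_1}, (Z_3Z_1)^{m_2+1} − α_3α_1 Z_2^{r-m_2},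 and Z_1Z_2Z_3 − α_1α_2α_3 is A_r(3)-invariant, and the classes of the (r+1)^2 monomials lying outside the monomial ideal ⟨Z_1^{r+2-m_1}, Z_2^{r+1-m_2}, Z_3^{r+1-m_3}, (Z_1Z_2)^{m_3+1}, (Z_2Z_3)^{m_1}, (Z_3Z_1)^{m_2+1}, Z_1Z_2Z_3⟩ form a ℂ-basis of ℂ[Z_1,Z_2,Z_3]/I; in particular dim_ℂ ℂ[Z_1,Z_2,Z_3]/I = (r+1)^2. -/
open MvPolynomial

namespace BinomialIdeal

/-- The ideal generated by the binomials `Z ^ p i - c i * Z ^ q i`. -/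
noncomputable def binomialIdeal {σ ι K : Type*} [Field K] (p q : ι → σ →₀ ℕ) (c : ι → K) :
    Ideal (MvPolynomial σ K) :=
  Ideal.span (Set.range fun i => monomial (p i) (1 : K) - monomial (q i) (c i))

/-- The monomial ideal generated by the `Z ^ p i`. -/
noncomputable def monomialIdeal {σ ι : Type*} (K : Type*) [Field K] (p : ι → σ →₀ ℕ) :
    Ideal (MvPolynomial σ K) :=
  Ideal.span (Set.range fun i => monomial (p i) (1 : K))

theorem monomial_mem_monomialIdeal_iff {σ ι K : Type*} [Field K] (p : ι → σ →₀ ℕ)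
    (m : σ →₀ ℕ) : monomial m (1 : K) ∈ monomialIdeal K p ↔ ∃ i, p i ≤ m := by
  have h : (Set.range fun i => monomial (p i) (1 : K)) =
      (fun s => monomial s (1 : K)) '' Set.range p := by
    rw [← Set.range_comp]; rfl
  rw [monomialIdeal, h, mem_ideal_span_monomial_image]
  classical simp [support_monomial]

theorem mk_monomial_add {σ ι K : Type*} [Field K] (p q : ι → σ →₀ ℕ) (c : ι → K)
    (u : σ →₀ ℕ) (i : ι) :
    Ideal.Quotient.mk (binomialIdeal p q c) (monomial (u + p i) (1 : K)) =
      c i • Ideal.Quotient.mk (binomialIdeal p q c) (monomial (u + q i) (1 : K)) := by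
  have h : monomial (u + p i) (1 : K) - c i • monomial (u + q i) (1 : K) =
      monomial u (1 : K) * (monomial (p i) (1 : K) - monomial (q i) (c i)) := by
    simp [mul_sub, monomial_mul, smul_monomial]
  have h' : c i • Ideal.Quotient.mk (binomialIdeal p q c) (monomial (u + q i) (1 : K)) =
      Ideal.Quotient.mk (binomialIdeal p q c) (c i • monomial (u + q i) (1 : K)) := rfl
  rw [h', Ideal.Quotient.eq, h]
  exact Ideal.mul_mem_left _ _ (Ideal.subset_span ⟨i, rfl⟩)

/-- Standard monomials span if the rewriting rules `p i → q i` decrease a weight. -/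
theorem span_standard_monomials {σ ι K : Type*} [Field K] (p q : ι → σ →₀ ℕ) (c : ι → K)
    (w : (σ →₀ ℕ) → ℕ) (hw : ∀ u i, w (u + q i) < w (u + p i)) :
    Submodule.span K (Set.range
      fun m : {m : σ →₀ ℕ // monomial m (1 : K) ∉ monomialIdeal K p} =>
        Ideal.Quotient.mk (binomialIdeal p q c) (monomial m.1 (1 : K))) = ⊤ := by
  set V := Submodule.span K (Set.range
      fun m : {m : σ →₀ ℕ // monomial m (1 : K) ∉ monomialIdeal K p} =>
        Ideal.Quotient.mk (binomialIdeal p q c) (monomial m.1 (1 : K)))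
  have key : ∀ n m, w m = n →
      Ideal.Quotient.mk (binomialIdeal p q c) (monomial m (1 : K)) ∈ V := by
    intro n
    induction n using Nat.strong_induction_on with
    | _ n ih =>
      intro m hm
      by_cases h : monomial m (1 : K) ∈ monomialIdeal K p
      · obtain ⟨i, hi⟩ := (monomial_mem_monomialIdeal_iff p m).1 h
        obtain ⟨u, rfl⟩ : ∃ u, m = u + p i := ⟨m - p i, (tsub_add_cancel_of_le hi).symm⟩
        rw [mk_monomial_add]
        exact V.smul_mem _ (ih _ (hm ▸ hw u i) _ rfl)
      · exact Submodule.subset_span ⟨⟨m, h⟩, rfl⟩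
  rw [eq_top_iff]
  rintro x -
  obtain ⟨f, rfl⟩ := Ideal.Quotient.mk_surjective x
  induction f using MvPolynomial.induction_on' with
  | monomial u t =>
    have h : Ideal.Quotient.mk (binomialIdeal p q c) (monomial u t) =
        t • Ideal.Quotient.mk (binomialIdeal p q c) (monomial u (1 : K)) := by
      rw [show monomial u t = t • monomial u (1 : K) by simp [smul_monomial]]
      rfl
    rw [h]
    exact V.smul_mem _ (key _ u rfl)
  | add f g hf hg =>
    rw [map_add]
    exact V.add_mem hf hg

/-- If the rules decrease a weight and preserve `cls`, every class contains a standard monomial. -/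
theorem exists_standard_monomial {σ ι K G : Type*} [Field K] (p q : ι → σ →₀ ℕ)
    (w : (σ →₀ ℕ) → ℕ) (hw : ∀ u i, w (u + q i) < w (u + p i))
    (cls : (σ →₀ ℕ) → G) (hcls : ∀ u i, cls (u + p i) = cls (u + q i)) (v : σ →₀ ℕ) :
    ∃ m, monomial m (1 : K) ∉ monomialIdeal K p ∧ cls m = cls v := by
  induction h : w v using Nat.strong_induction_on generalizing v with
  | _ n ih =>
    by_cases hv : monomial v (1 : K) ∈ monomialIdeal K p
    · obtain ⟨i, hi⟩ := (monomial_mem_monomialIdeal_iff p v).1 hv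
      obtain ⟨u, rfl⟩ : ∃ u, v = u + p i := ⟨v - p i, (tsub_add_cancel_of_le hi).symm⟩
      obtain ⟨m, hm, hm'⟩ := ih _ (h ▸ hw u i) _ rfl
      exact ⟨m, hm, hm'.trans (hcls u i).symm⟩
    · exact ⟨v, hv, rfl⟩

/-- The linear map sending `Z ^ v` to `κ v` times the basis vector of the class of `v`. -/
noncomputable def classMap {σ K G : Type*} [Field K] (cls : (σ →₀ ℕ) → G) (κ : (σ →₀ ℕ) → K) :
    MvPolynomial σ K →ₗ[K] G →₀ K :=
  (basisMonomials σ K).constr K fun v => Finsupp.single (cls v) (κ v)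

theorem classMap_monomial {σ K G : Type*} [Field K] (cls : (σ →₀ ℕ) → G) (κ : (σ →₀ ℕ) → K)
    (v : σ →₀ ℕ) (t : K) :
    classMap cls κ (monomial v t) = Finsupp.single (cls v) (t * κ v) := by
  have h := (basisMonomials σ K).constr_basis K (fun v => Finsupp.single (cls v) (κ v)) v
  rw [coe_basisMonomials] at h
  rw [show monomial v t = t • monomial v (1 : K) by simp [smul_monomial], map_smul, classMap, h]
  simp

theorem classMap_eq_zero {σ ι K G : Type*} [Field K] (p q : ι → σ →₀ ℕ) (c : ι → K)
    (cls : (σ →₀ ℕ) → G) (hcls : ∀ u i, cls (u + p i) = cls (u + q i))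
    (κ : (σ →₀ ℕ) → K) (hκ : ∀ u i, κ (u + p i) = c i * κ (u + q i))
    (f : MvPolynomial σ K) (hf : f ∈ binomialIdeal p q c) : classMap cls κ f = 0 := by
  have key : ∀ g, classMap cls κ (g * f) = 0 := by
    refine Submodule.span_induction ?_ ?_ ?_ ?_ hf
    · rintro _ ⟨i, rfl⟩ g
      induction g using MvPolynomial.induction_on' with
      | monomial u t =>
        simp only [mul_sub, monomial_mul, map_sub, classMap_monomial, hcls, hκ, mul_one,
          mul_assoc, sub_self]
      | add g h hg hh => rw [add_mul, map_add, hg, hh, add_zero]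
    · simp
    · intro x y _ _ hx hy g
      rw [mul_add, map_add, hx, hy, add_zero]
    · intro a x _ hx g
      rw [smul_eq_mul, ← mul_assoc, hx]
  simpa using key 1

/-- Standard monomials are linearly independent if they lie in distinct classes and there is a
function `κ` compatible with the rules which does not vanish on them. -/
theorem linearIndependent_standard_monomials {σ ι K G : Type*} [Field K]
    (p q : ι → σ →₀ ℕ) (c : ι → K)
    (cls : (σ →₀ ℕ) → G) (hcls : ∀ u i, cls (u + p i) = cls (u + q i))
    (κ : (σ →₀ ℕ) → K) (hκ : ∀ u i, κ (u + p i) = c i * κ (u + q i))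
    (hone : ∀ m, monomial m (1 : K) ∉ monomialIdeal K p → κ m = 1)
    (hinj : ∀ m m', monomial m (1 : K) ∉ monomialIdeal K p →
      monomial m' (1 : K) ∉ monomialIdeal K p → cls m = cls m' → m = m') :
    LinearIndependent K
      fun m : {m : σ →₀ ℕ // monomial m (1 : K) ∉ monomialIdeal K p} =>
        Ideal.Quotient.mk (binomialIdeal p q c) (monomial m.1 (1 : K)) := by
  let N : (MvPolynomial σ K ⧸ binomialIdeal p q c) →ₗ[K] G →₀ K :=
    ((binomialIdeal p q c).restrictScalars K).liftQ (classMap cls κ)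
      (fun f hf => classMap_eq_zero p q c cls hcls κ hκ f hf)
  have hN : ∀ f, N (Ideal.Quotient.mk (binomialIdeal p q c) f) = classMap cls κ f :=
    fun f => rfl
  apply LinearIndependent.of_comp N
  have h : (N ∘ fun m : {m : σ →₀ ℕ // monomial m (1 : K) ∉ monomialIdeal K p} =>
        Ideal.Quotient.mk (binomialIdeal p q c) (monomial m.1 (1 : K))) =
      (fun g => Finsupp.single g (1 : K)) ∘
        fun m : {m : σ →₀ ℕ // monomial m (1 : K) ∉ monomialIdeal K p} => cls m.1 := by
    funext m
    simp [hN, classMap_monomial, hone m.1 m.2]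
  rw [h]
  exact (Finsupp.linearIndependent_single_one K G).comp _
    fun m m' hm => Subtype.ext (hinj _ _ m.2 m'.2 hm)

end BinomialIdeal

namespace ArThree

open BinomialIdeal

/-- The exponent vector `(x, y, z)`. -/
noncomputable def expo (x y z : ℕ) : Fin 3 →₀ ℕ := Finsupp.equivFunOnFinite.symm ![x, y, z]

@[simp] theorem expo_zero (x y z : ℕ) : expo x y z 0 = x := rfl
@[simp] theorem expo_one (x y z : ℕ) : expo x y z 1 = y := rfl
@[simp] theorem expo_two (x y z : ℕ) : expo x y z 2 = z := rfl

theorem expo_le_iff (x y z : ℕ) (m : Fin 3 →₀ ℕ) :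
    expo x y z ≤ m ↔ x ≤ m 0 ∧ y ≤ m 1 ∧ z ≤ m 2 := by
  rw [Finsupp.le_def, Fin.forall_fin_succ, Fin.forall_fin_succ, Fin.forall_fin_one]
  rfl

theorem monomial_expo (x y z : ℕ) (t : ℂ) :
    monomial (expo x y z) t = C t * (X 0 ^ x * X 1 ^ y * X 2 ^ z) := by
  rw [monomial_eq, Finsupp.prod_fintype _ _ (by simp)]
  simp [Fin.prod_univ_three]

/-- Leading exponents of the seven relations. -/
noncomputable def lead (a b c : ℕ) : Fin 7 → Fin 3 →₀ ℕ :=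
  ![expo (b + c + 1) 0 0, expo 0 (a + c + 1) 0, expo 0 0 (a + b + 1),
    expo (c + 1) (c + 1) 0, expo 0 (a + 1) (a + 1), expo (b + 1) 0 (b + 1), expo 1 1 1]

/-- Trailing exponents of the seven relations. -/
noncomputable def trail (a b c : ℕ) : Fin 7 → Fin 3 →₀ ℕ :=
  ![expo 0 a a, expo b 0 b, expo c c 0,
    expo 0 0 (a + b), expo (b + c) 0 0, expo 0 (a + c) 0, expo 0 0 0]

/-- The exponents of the parameters in the seven relations. -/
def paramExp : Fin 7 → Fin 3 → ℕ :=
  ![![1, 0, 0], ![0, 1, 0], ![0, 0, 1], ![1, 1, 0], ![0, 1, 1], ![1, 0, 1], ![1, 1, 1]]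

/-- The coefficients of the trailing terms of the seven relations. -/
noncomputable def coeffs (α : Fin 3 → ℂ) (i : Fin 7) : ℂ := ∏ j, α j ^ paramExp i j

/-- The degree of a monomial in the `j`-th parameter, multiplied by `a + b + c + 1`. -/
def paramDeg (a b c : ℕ) (j : Fin 3) (v : Fin 3 →₀ ℕ) : ℕ :=
  v j + (a * v 0 + b * v 1 + c * v 2)

/-- The character of `A_r(3)` on a monomial. -/
def weightClass (r : ℕ) (v : Fin 3 →₀ ℕ) : ZMod (r + 1) × ZMod (r + 1) :=
  ((v 0 : ZMod (r + 1)) - v 2, (v 1 : ZMod (r + 1)) - v 2)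

theorem paramDeg_lead (a b c : ℕ) (j : Fin 3) (u : Fin 3 →₀ ℕ) (i : Fin 7) :
    paramDeg a b c j (u + lead a b c i) =
      paramDeg a b c j (u + trail a b c i) + (a + b + c + 1) * paramExp i j := by
  fin_cases i <;> fin_cases j <;> simp [paramDeg, lead, trail, paramExp] <;> ring

theorem weightClass_lead (a b c : ℕ) (u : Fin 3 →₀ ℕ) (i : Fin 7) :
    weightClass (a + b + c) (u + lead a b c i) = weightClass (a + b + c) (u + trail a b c i) := by
  have h : ((a : ZMod (a + b + c + 1)) + b + c + 1) = 0 := by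
    exact_mod_cast ZMod.natCast_self (a + b + c + 1)
  fin_cases i <;> simp [weightClass, lead, trail] <;> grind

/-- The least value of `paramDeg` on a class. -/
noncomputable def minDeg (a b c : ℕ) (j : Fin 3)
    (g : ZMod (a + b + c + 1) × ZMod (a + b + c + 1)) : ℕ :=
  sInf (paramDeg a b c j '' {v | weightClass (a + b + c) v = g})

theorem minDeg_le (a b c : ℕ) (j : Fin 3) (v : Fin 3 →₀ ℕ) :
    minDeg a b c j (weightClass (a + b + c) v) ≤ paramDeg a b c j v :=
  Nat.sInf_le ⟨v, rfl, rfl⟩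

/-- The product of parameters by which a monomial differs from the standard one of its class. -/
noncomputable def reductionCoeff (a b c : ℕ) (α : Fin 3 → ℂ) (v : Fin 3 →₀ ℕ) : ℂ :=
  ∏ j, α j ^ ((paramDeg a b c j v - minDeg a b c j (weightClass (a + b + c) v)) / (a + b + c + 1))

theorem reductionCoeff_lead (a b c : ℕ) (α : Fin 3 → ℂ) (u : Fin 3 →₀ ℕ) (i : Fin 7) :
    reductionCoeff a b c α (u + lead a b c i) =
      coeffs α i * reductionCoeff a b c α (u + trail a b c i) := by
  rw [reductionCoeff, reductionCoeff, coeffs, ← Finset.prod_mul_distrib]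
  refine Finset.prod_congr rfl fun j _ => ?_
  have h := minDeg_le a b c j (u + trail a b c i)
  rw [paramDeg_lead, weightClass_lead, ← pow_add, Nat.sub_add_comm h,
    Nat.add_mul_div_left _ _ (Nat.succ_pos _), add_comm]

/-- If `m` exceeds `v` by a lattice vector with a positive coordinate in the basis of relations,
then `m` is divisible by a leading monomial. -/
theorem exists_lead_le (a b c : ℕ) (m v : Fin 3 →₀ ℕ) (l₀ l₁ l₂ : ℤ)
    (h₀ : (m 0 : ℤ) = v 0 + (b + c + 1) * l₀ - b * l₁ - c * l₂)
    (h₁ : (m 1 : ℤ) = v 1 + (a + c + 1) * l₁ - a * l₀ - c * l₂)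
    (h₂ : (m 2 : ℤ) = v 2 + (a + b + 1) * l₂ - a * l₀ - b * l₁)
    (hl : 0 < l₀ ∨ 0 < l₁ ∨ 0 < l₂) : ∃ i, lead a b c i ≤ m := by
  by_contra! hm
  have key : ∀ (x y b c : ℕ) (l l' l'' : ℤ), (x : ℤ) = y + (b + c + 1) * l - b * l' - c * l'' →
      0 < l → l' ≤ l → l'' ≤ l → 1 ≤ x ∧ (l' < l → b + 1 ≤ x) ∧ (l'' < l → c + 1 ≤ x) ∧
        (l' < l → l'' < l → b + c + 1 ≤ x) := by
    intro x y b c l l' l'' hx hl h' h''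
    have hb := mul_nonneg (Int.natCast_nonneg b) (sub_nonneg.2 h')
    have hc := mul_nonneg (Int.natCast_nonneg c) (sub_nonneg.2 h'')
    have hb' : l' < l → (b : ℤ) ≤ b * (l - l') := fun h =>
      le_mul_of_one_le_right (Int.natCast_nonneg b) (by omega)
    have hc' : l'' < l → (c : ℤ) ≤ c * (l - l'') := fun h =>
      le_mul_of_one_le_right (Int.natCast_nonneg c) (by omega)
    have hx' : (x : ℤ) = y + b * (l - l') + c * (l - l'') + l := by rw [hx]; ring
    generalize (b : ℤ) * (l - l') = B at *
    generalize (c : ℤ) * (l - l'') = C at *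
    clear hx
    omega
  have k₀ := key _ _ _ _ _ _ _ h₀
  have k₁ := key _ _ _ _ _ _ _ h₁
  have k₂ := key _ _ _ _ _ _ _ h₂
  have e₀ := hm 0
  have e₁ := hm 1
  have e₂ := hm 2
  have e₃ := hm 3
  have e₄ := hm 4
  have e₅ := hm 5
  have e₆ := hm 6
  simp only [lead, expo_le_iff, Matrix.cons_val, zero_le, true_and, and_true, not_and, not_le]
    at e₀ e₁ e₂ e₃ e₄ e₅ e₆
  clear h₀ h₁ h₂ hm key
  omega

/-- Standard monomials minimise every parameter degree in their class. -/
theorem paramDeg_le (a b c : ℕ) (m v : Fin 3 →₀ ℕ) (hm : ∀ i, ¬ lead a b c i ≤ m)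
    (h : weightClass (a + b + c) v = weightClass (a + b + c) m) (j : Fin 3) :
    paramDeg a b c j m ≤ paramDeg a b c j v := by
  obtain ⟨h₀, h₁⟩ := Prod.ext_iff.1 h
  have h₀' : (((v 0 : ℤ) - v 2 : ℤ) : ZMod (a + b + c + 1)) = ((m 0 : ℤ) - m 2 : ℤ) := by
    push_cast; exact h₀
  have h₁' : (((v 1 : ℤ) - v 2 : ℤ) : ZMod (a + b + c + 1)) = ((m 1 : ℤ) - m 2 : ℤ) := by
    push_cast; exact h₁
  obtain ⟨k₀, hk₀⟩ := (ZMod.intCast_eq_intCast_iff_dvd_sub _ _ _).1 h₀'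
  obtain ⟨k₁, hk₁⟩ := (ZMod.intCast_eq_intCast_iff_dvd_sub _ _ _).1 h₁'
  push_cast at hk₀ hk₁
  obtain ⟨l, hl⟩ : ∃ l : ℤ, l = m 2 - v 2 + a * k₀ + b * k₁ := ⟨_, rfl⟩
  by_contra! hlt
  obtain ⟨i, hi⟩ := exists_lead_le a b c m v (l + k₀) (l + k₁) l
    (by linear_combination hk₀ - hl) (by linear_combination hk₁ - hl)
    (by linear_combination -hl) (by
      have hn : (0 : ℤ) ≤ a + b + c + 1 := by positivity
      zify at hlt
      fin_cases j <;> simp [paramDeg] at hlt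
      · exact Or.inl (by nlinarith)
      · exact Or.inr (Or.inl (by nlinarith))
      · exact Or.inr (Or.inr (by nlinarith)))
  exact hm i hi

theorem paramDeg_injective (a b c : ℕ) (m v : Fin 3 →₀ ℕ)
    (h : ∀ j, paramDeg a b c j m = paramDeg a b c j v) : m = v := by
  have h₀ := h 0
  have h₁ := h 1
  have h₂ := h 2
  simp only [paramDeg] at h₀ h₁ h₂
  zify at h₀ h₁ h₂
  have hn : (a : ℤ) + b + c + 1 ≠ 0 := by positivity
  have e₂ : (m 2 : ℤ) = v 2 := mul_left_cancel₀ hn (by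
    linear_combination (1 + (a : ℤ) + b) * h₂ - a * h₀ - b * h₁)
  have e₀ : (m 0 : ℤ) = v 0 := by linear_combination h₀ - h₂ + e₂
  have e₁ : (m 1 : ℤ) = v 1 := by linear_combination h₁ - h₂ + e₂
  ext j
  fin_cases j
  · exact_mod_cast e₀
  · exact_mod_cast e₁
  · exact_mod_cast e₂

theorem reductionCoeff_eq_one (a b c : ℕ) (α : Fin 3 → ℂ) (m : Fin 3 →₀ ℕ)
    (hm : ∀ i, ¬ lead a b c i ≤ m) : reductionCoeff a b c α m = 1 := by
  refine Finset.prod_eq_one fun j _ => ?_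
  obtain ⟨v, hv, hv'⟩ := Nat.sInf_mem
    (s := paramDeg a b c j '' {v | weightClass (a + b + c) v = weightClass (a + b + c) m})
    ⟨_, m, rfl, rfl⟩
  have h : paramDeg a b c j m ≤ minDeg a b c j (weightClass (a + b + c) m) :=
    (paramDeg_le a b c m v hm hv j).trans_eq hv'
  rw [Nat.sub_eq_zero_of_le h, Nat.zero_div, pow_zero]

theorem weightClass_injOn (a b c : ℕ) (m m' : Fin 3 →₀ ℕ) (hm : ∀ i, ¬ lead a b c i ≤ m)
    (hm' : ∀ i, ¬ lead a b c i ≤ m')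
    (h : weightClass (a + b + c) m = weightClass (a + b + c) m') : m = m' :=
  paramDeg_injective a b c m m' fun j => le_antisymm
    (paramDeg_le a b c m m' hm h.symm j) (paramDeg_le a b c m' m hm' h j)

theorem weightClass_surjective (r : ℕ) : Function.Surjective (weightClass r) := by
  rintro ⟨x, y⟩
  refine ⟨expo x.val y.val 0, ?_⟩
  simp [weightClass]

theorem weight_trail_lt (a b c : ℕ) (u : Fin 3 →₀ ℕ) (i : Fin 7) :
    ∑ j, paramDeg a b c j (u + trail a b c i) < ∑ j, paramDeg a b c j (u + lead a b c i) := by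
  simp only [paramDeg_lead, Finset.sum_add_distrib, ← Finset.mul_sum]
  have h : 0 < ∑ j, paramExp i j := by
    fin_cases i <;> simp [paramExp, Fin.sum_univ_three]
  exact Nat.lt_add_of_pos_right (Nat.mul_pos (Nat.succ_pos (a + b + c)) h)

theorem card_standard_monomials (a b c : ℕ) :
    Nat.card {m : Fin 3 →₀ ℕ // monomial m (1 : ℂ) ∉ monomialIdeal ℂ (lead a b c)} =
      (a + b + c + 1) ^ 2 := by
  have h : Function.Bijective
      fun m : {m : Fin 3 →₀ ℕ // monomial m (1 : ℂ) ∉ monomialIdeal ℂ (lead a b c)} =>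
        weightClass (a + b + c) m.1 := by
    constructor
    · rintro ⟨m, hm⟩ ⟨m', hm'⟩ h
      rw [monomial_mem_monomialIdeal_iff, not_exists] at hm hm'
      exact Subtype.ext (weightClass_injOn a b c m m' hm hm' h)
    · intro g
      obtain ⟨v, rfl⟩ := weightClass_surjective (a + b + c) g
      obtain ⟨m, hm, hm'⟩ := exists_standard_monomial (K := ℂ) _ _
        (fun v => ∑ j, paramDeg a b c j v) (weight_trail_lt a b c)
        _ (weightClass_lead a b c) v
      exact ⟨⟨m, hm⟩, hm'⟩
  rw [Nat.card_eq_of_bijective _ h, Nat.card_prod, Nat.card_zmod, sq]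

theorem actA_monomial_expo (d : Fin 3 → ℂˣ) (x y z : ℕ) (t : ℂ) :
    actA d (monomial (expo x y z) t) =
      C ((d 0 : ℂ) ^ x * (d 1 : ℂ) ^ y * (d 2 : ℂ) ^ z) * monomial (expo x y z) t := by
  simp only [monomial_expo, actA, map_mul, map_pow, aeval_X, aeval_C, algebraMap_eq]
  ring

theorem actA_mem_binomialIdeal (a b c : ℕ) (α : Fin 3 → ℂ) (g : ArGroup (a + b + c) 3)
    (f : MvPolynomial (Fin 3) ℂ)
    (hf : f ∈ binomialIdeal (lead a b c) (trail a b c) (coeffs α)) :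
    actA (g : Fin 3 → ℂˣ) f ∈ binomialIdeal (lead a b c) (trail a b c) (coeffs α) := by
  obtain ⟨d, hd, hprod⟩ := g
  obtain ⟨x, y, z, hx, hy, hz⟩ : ∃ x y z : ℂ, x = d 0 ∧ y = d 1 ∧ z = d 2 :=
    ⟨_, _, _, rfl, rfl, rfl⟩
  have hxyz : x * y * z = 1 := by
    rw [hx, hy, hz, ← Units.val_mul, ← Units.val_mul, ← Fin.prod_univ_three, hprod, Units.val_one]
  have hpow : ∀ i, (d i : ℂ) ^ (a + b + c + 1) = 1 := fun i => by
    rw [← Units.val_pow_eq_pow_val, hd, Units.val_one]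
  have hx' : x ^ (a + b + c + 1) = 1 := hx ▸ hpow 0
  have hy' : y ^ (a + b + c + 1) = 1 := hy ▸ hpow 1
  have hz' : z ^ (a + b + c + 1) = 1 := hz ▸ hpow 2
  have key : ∀ i, ∃ t : ℂ,
      actA d (monomial (lead a b c i) (1 : ℂ) - monomial (trail a b c i) (coeffs α i)) =
        C t * (monomial (lead a b c i) (1 : ℂ) - monomial (trail a b c i) (coeffs α i)) := by
    have aux : ∀ e₀ e₁ e₂ f₀ f₁ f₂ : ℕ, ∀ s : ℂ,
        x ^ e₀ * y ^ e₁ * z ^ e₂ = x ^ f₀ * y ^ f₁ * z ^ f₂ → ∃ t : ℂ,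
        actA d (monomial (expo e₀ e₁ e₂) (1 : ℂ) - monomial (expo f₀ f₁ f₂) s) =
          C t * (monomial (expo e₀ e₁ e₂) (1 : ℂ) - monomial (expo f₀ f₁ f₂) s) := by
      intro e₀ e₁ e₂ f₀ f₁ f₂ s h
      refine ⟨x ^ e₀ * y ^ e₁ * z ^ e₂, ?_⟩
      rw [map_sub, actA_monomial_expo, actA_monomial_expo, mul_sub, ← hx, ← hy, ← hz, ← h]
    have hpow' : ∀ k, (x * y * z) ^ k = 1 := fun k => by rw [hxyz, one_pow]
    intro i
    fin_cases i <;> refine aux _ _ _ _ _ _ _ ?_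
    · linear_combination -x ^ (b + c + 1) * hpow' a + (y * z) ^ a * hx'
    · linear_combination -y ^ (a + c + 1) * hpow' b + (x * z) ^ b * hy'
    · linear_combination -z ^ (a + b + 1) * hpow' c + (x * y) ^ c * hz'
    · linear_combination -(x * y) ^ (c + 1) * hz' + z ^ (a + b) * hpow' (c + 1)
    · linear_combination -(y * z) ^ (a + 1) * hx' + x ^ (b + c) * hpow' (a + 1)
    · linear_combination -(x * z) ^ (b + 1) * hy' + y ^ (a + c) * hpow' (b + 1)
    · linear_combination hxyz
  change f ∈ (binomialIdeal (lead a b c) (trail a b c) (coeffs α)).comap (actA d)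
  refine (Ideal.span_le.2 ?_) hf
  rintro _ ⟨i, rfl⟩
  obtain ⟨t, ht⟩ := key i
  change actA d (monomial (lead a b c i) (1 : ℂ) - monomial (trail a b c i) (coeffs α i)) ∈
    binomialIdeal (lead a b c) (trail a b c) (coeffs α)
  rw [ht]
  exact Ideal.mul_mem_left _ _ (Ideal.subset_span ⟨i, rfl⟩)

theorem binomialIdeal_eq (a b c : ℕ) (α₁ α₂ α₃ : ℂ) :
    Ideal.span {(X 0 : MvPolynomial (Fin 3) ℂ) ^ (b + c + 1) - C α₁ * (X 1 * X 2) ^ a,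
        X 1 ^ (a + c + 1) - C α₂ * (X 2 * X 0) ^ b,
        X 2 ^ (a + b + 1) - C α₃ * (X 0 * X 1) ^ c,
        (X 0 * X 1) ^ (c + 1) - C (α₁ * α₂) * X 2 ^ (a + b),
        (X 1 * X 2) ^ (a + 1) - C (α₂ * α₃) * X 0 ^ (b + c),
        (X 2 * X 0) ^ (b + 1) - C (α₃ * α₁) * X 1 ^ (a + c),
        X 0 * X 1 * X 2 - C (α₁ * α₂ * α₃)} =
      binomialIdeal (lead a b c) (trail a b c) (coeffs ![α₁, α₂, α₃]) := by
  rw [binomialIdeal, mul_comm (X 2) (X 0), mul_comm α₃ α₁]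
  congr 1
  ext f
  simp [Fin.exists_fin_succ, lead, trail, coeffs, paramExp, monomial_expo, Fin.prod_univ_three,
    mul_pow, eq_comm (a := f)]

theorem monomialIdeal_eq (a b c : ℕ) :
    Ideal.span {(X 0 : MvPolynomial (Fin 3) ℂ) ^ (b + c + 1), X 1 ^ (a + c + 1),
        X 2 ^ (a + b + 1), (X 0 * X 1) ^ (c + 1), (X 1 * X 2) ^ (a + 1), (X 2 * X 0) ^ (b + 1),
        X 0 * X 1 * X 2} =
      monomialIdeal ℂ (lead a b c) := by
  rw [monomialIdeal, mul_comm (X 2) (X 0)]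
  congr 1
  ext f
  simp [Fin.exists_fin_succ, lead, monomial_expo, mul_pow, eq_comm (a := f)]

end ArThree

open ArThree BinomialIdeal

/-- The deformed ideal `I` (with parameters `α_1, α_2, α_3`) is
`A_r(3)`-invariant, and the classes of the `(r+1)^2` monomials lying outside the
corresponding monomial ideal `J` form a `ℂ`-basis of `ℂ[Z_1,Z_2,Z_3]/I`; in
particular the quotient has dimension `(r+1)^2`. -/
theorem Ar3_deformed_ideal_basis (r m1 m2 m3 : ℕ) (α1 α2 α3 : ℂ) (hr : 1 ≤ r)
    (hm1 : 1 ≤ m1) (hsum : m1 + m2 + m3 = r + 1) :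
    let I : Ideal (MvPolynomial (Fin 3) ℂ) :=
      Ideal.span {(X 0 : MvPolynomial (Fin 3) ℂ) ^ (r + 2 - m1) - C α1 * (X 1 * X 2) ^ (m1 - 1),
        X 1 ^ (r + 1 - m2) - C α2 * (X 2 * X 0) ^ m2,
        X 2 ^ (r + 1 - m3) - C α3 * (X 0 * X 1) ^ m3,
        (X 0 * X 1) ^ (m3 + 1) - C (α1 * α2) * X 2 ^ (r - m3),
        (X 1 * X 2) ^ m1 - C (α2 * α3) * X 0 ^ (r + 1 - m1),
        (X 2 * X 0) ^ (m2 + 1) - C (α3 * α1) * X 1 ^ (r - m2),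
        X 0 * X 1 * X 2 - C (α1 * α2 * α3)}
    let J : Ideal (MvPolynomial (Fin 3) ℂ) :=
      Ideal.span {(X 0 : MvPolynomial (Fin 3) ℂ) ^ (r + 2 - m1),
        X 1 ^ (r + 1 - m2), X 2 ^ (r + 1 - m3),
        (X 0 * X 1) ^ (m3 + 1), (X 1 * X 2) ^ m1, (X 2 * X 0) ^ (m2 + 1),
        X 0 * X 1 * X 2}
    let fam : {m : Fin 3 →₀ ℕ // (monomial m (1 : ℂ) : MvPolynomial (Fin 3) ℂ) ∉ J} →
        MvPolynomial (Fin 3) ℂ ⧸ I :=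
      fun m => Ideal.Quotient.mk I (monomial m.1 (1 : ℂ))
    (∀ g : ArGroup r 3, ∀ p ∈ I, actA (g : Fin 3 → ℂˣ) p ∈ I) ∧
    LinearIndependent ℂ fam ∧
    Submodule.span ℂ (Set.range fam) = ⊤ ∧
    Module.finrank ℂ (MvPolynomial (Fin 3) ℂ ⧸ I) = (r + 1) ^ 2 := by
  intro I J fam
  obtain ⟨a, rfl⟩ : ∃ a, m1 = a + 1 := ⟨m1 - 1, by omega⟩
  obtain rfl : r = a + m2 + m3 := by omega
  have e₁ : a + m2 + m3 + 2 - (a + 1) = m2 + m3 + 1 := by omega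
  have e₂ : a + m2 + m3 + 1 - m2 = a + m3 + 1 := by omega
  have e₃ : a + m2 + m3 + 1 - m3 = a + m2 + 1 := by omega
  have e₄ : a + m2 + m3 + 1 - (a + 1) = m2 + m3 := by omega
  have e₅ : a + m2 + m3 - m3 = a + m2 := by omega
  have e₆ : a + m2 + m3 - m2 = a + m3 := by omega
  have hI : I = binomialIdeal (lead a m2 m3) (trail a m2 m3) (coeffs ![α1, α2, α3]) := by
    rw [← binomialIdeal_eq]
    simp only [I, e₁, e₂, e₃, e₄, e₅, e₆, Nat.add_sub_cancel]
  have hJ : J = monomialIdeal ℂ (lead a m2 m3) := by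
    rw [← monomialIdeal_eq]
    simp only [J, e₁, e₂, e₃]
  clear_value I J
  subst hI hJ
  have hli : LinearIndependent ℂ fam :=
    linearIndependent_standard_monomials _ _ _ _ (weightClass_lead a m2 m3) _
      (reductionCoeff_lead a m2 m3 _)
      (fun m hm => reductionCoeff_eq_one a m2 m3 _ m
        (by rwa [monomial_mem_monomialIdeal_iff, not_exists] at hm))
      (fun m m' hm hm' => weightClass_injOn a m2 m3 m m'
        (by rwa [monomial_mem_monomialIdeal_iff, not_exists] at hm)
        (by rwa [monomial_mem_monomialIdeal_iff, not_exists] at hm'))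
  have hspan : Submodule.span ℂ (Set.range fam) = ⊤ :=
    span_standard_monomials _ _ _ (fun v => ∑ j, paramDeg a m2 m3 j v) (weight_trail_lt a m2 m3)
  refine ⟨actA_mem_binomialIdeal a m2 m3 _, hli, hspan, ?_⟩
  rw [Module.finrank_eq_nat_card_basis (Module.Basis.mk hli hspan.ge), card_standard_monomials]
end
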